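/- Let (c,u) be a travelling-wave solution of the one-species free-boundary problem such that u is globally Lipschitz, ∂ₓu < 0 on Ω = {u > 0}, the free boundary is Γ = {(φ(y), y) : y < 0} with φ real-analytic, φ Lipschitz on (-∞,-1], φ'(y) → -cotan α (α ∈ (0,π/2)) and φ''(y) → 0 as y → -∞. Then there exists ρ > 0 such that u(x,y) ≥ 1 - e^{-ρ·dist((x,y),Γ)} at every point (x,y) with u(x,y) > 0. -/

import Mathlib

open Real Filter Topology Set Asymptotics

noncomputable section

/-- Partial derivative in the first (horizontal) variable. -/
def pdx (u : ℝ → ℝ → ℝ) (x y : ℝ) : ℝ := deriv (fun t => u t y) x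

/-- Partial derivative in the second (vertical) variable. -/
def pdy (u : ℝ → ℝ → ℝ) (x y : ℝ) : ℝ := deriv (fun t => u x t) y

/-- Second partial derivative in the first variable. -/
def pdxx (u : ℝ → ℝ → ℝ) (x y : ℝ) : ℝ := deriv (fun t => pdx u t y) x

/-- Second partial derivative in the second variable. -/
def pdyy (u : ℝ → ℝ → ℝ) (x y : ℝ) : ℝ := deriv (fun t => pdy u x t) y

/-- The closed lower half-plane `H = {(x,y) : y ≤ 0}`. -/
def lowerH : Set (ℝ × ℝ) := {p | p.2 ≤ 0}

/-- The positivity set `Ω = {u > 0}` inside the closed lower half-plane. -/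
def posSet (u : ℝ → ℝ → ℝ) : Set (ℝ × ℝ) := {p | p.2 ≤ 0 ∧ 0 < u p.1 p.2}

/-- The free boundary `Γ = ∂Ω ∩ {y < 0}`. -/
def freeBdry (u : ℝ → ℝ → ℝ) : Set (ℝ × ℝ) :=
  frontier (posSet u) ∩ {p | p.2 < 0}

/-- A travelling-wave solution of the one-species free-boundary problem in the
lower half-plane, with diffusivities `d` (field), `D` (road), exchange parameter `μ`
and speed `c`. -/
structure OneSpeciesTW (d D μ c : ℝ) (u : ℝ → ℝ → ℝ) : Prop where
  c_pos : 0 < c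
  cont : ContinuousOn (fun p : ℝ × ℝ => u p.1 p.2) lowerH
  mem01 : ∀ x y : ℝ, y ≤ 0 → u x y ∈ Icc (0:ℝ) 1
  relOpen : ∃ V : Set (ℝ × ℝ), IsOpen V ∧ posSet u = V ∩ lowerH
  smooth : ContDiffOn ℝ 2 (fun p : ℝ × ℝ => u p.1 p.2) (posSet u ∩ {p | p.2 < 0})
  pde : ∀ p ∈ posSet u ∩ {p : ℝ × ℝ | p.2 < 0},
      -d * (pdxx u p.1 p.2 + pdyy u p.1 p.2) + c * pdx u p.1 p.2 = 0
  grad_ext : ∃ G₁ G₂ : ℝ × ℝ → ℝ,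
      ContinuousOn G₁ (posSet u ∪ freeBdry u) ∧
      ContinuousOn G₂ (posSet u ∪ freeBdry u) ∧
      (∀ p ∈ posSet u ∩ {p : ℝ × ℝ | p.2 < 0},
        G₁ p = pdx u p.1 p.2 ∧ G₂ p = pdy u p.1 p.2) ∧
      (∀ p ∈ freeBdry u, (G₁ p) ^ 2 + (G₂ p) ^ 2 = 1)
  road_diffx : ∀ x : ℝ, 0 < u x 0 → DifferentiableAt ℝ (fun t => u t 0) x
  road_diffxx : ∀ x : ℝ, 0 < u x 0 → DifferentiableAt ℝ (fun t => pdx u t 0) x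
  road_diffy : ∀ x : ℝ, 0 < u x 0 → DifferentiableAt ℝ (fun t => u x t) 0
  road : ∀ x : ℝ, 0 < u x 0 →
      -D * pdxx u x 0 + c * pdx u x 0 + (1/μ) * pdy u x 0 = 0
  lim_left : ∀ ε > 0, ∃ M : ℝ, ∀ x ≤ M, ∀ y ≤ (0:ℝ), |u x y - 1| < ε
  lim_right : ∀ y ≤ (0:ℝ), Tendsto (fun x => u x y) atTop (𝓝 0)


theorem second_deriv_nonneg {f : ℝ → ℝ} {a : ℝ} (h : IsLocalMin f a) (hc : ContinuousAt f a) :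
    0 ≤ deriv (deriv f) a := by
  by_contra hneg
  push Not at hneg
  have hmax : IsLocalMax f a := isLocalMax_of_deriv_deriv_neg hneg h.deriv_eq_zero hc
  have hcst : f =ᶠ[𝓝 a] fun _ => f a := by
    filter_upwards [h, hmax] with t h1 h2 using le_antisymm h2 h1
  have h1 : deriv f =ᶠ[𝓝 a] deriv (fun _ => f a) := hcst.deriv
  have h2 := h1.deriv_eq
  simp at h2
  linarith

theorem touch_below {f g g' : ℝ → ℝ} {a g'' : ℝ}
    (hf : ∀ᶠ t in 𝓝 a, DifferentiableAt ℝ f t) (hf2 : DifferentiableAt ℝ (deriv f) a)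
    (hg : ∀ᶠ t in 𝓝 a, HasDerivAt g (g' t) t) (hg2 : HasDerivAt g' g'' a)
    (hmin : IsLocalMin (fun t => f t - g t) a) :
    deriv f a = g' a ∧ g'' ≤ deriv (deriv f) a := by
  have hd : ∀ᶠ t in 𝓝 a, HasDerivAt (fun t => f t - g t) (deriv f t - g' t) t := by
    filter_upwards [hf, hg] with t h1 h2 using h1.hasDerivAt.sub h2
  have h0 := hmin.hasDerivAt_eq_zero hd.self_of_nhds
  have h1 : deriv (fun t => f t - g t) =ᶠ[𝓝 a] fun t => deriv f t - g' t := by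
    filter_upwards [hd] with t h using h.deriv
  have h2 : deriv (deriv (fun t => f t - g t)) a = deriv (deriv f) a - g'' := by
    rw [h1.deriv_eq]; exact (hf2.hasDerivAt.sub hg2).deriv
  have h3 := second_deriv_nonneg hmin hd.self_of_nhds.continuousAt
  constructor <;> linarith

theorem touch_above {f g g' : ℝ → ℝ} {a g'' : ℝ}
    (hf : ∀ᶠ t in 𝓝 a, DifferentiableAt ℝ f t) (hf2 : DifferentiableAt ℝ (deriv f) a)
    (hg : ∀ᶠ t in 𝓝 a, HasDerivAt g (g' t) t) (hg2 : HasDerivAt g' g'' a)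
    (hmax : IsLocalMax (fun t => f t - g t) a) :
    deriv f a = g' a ∧ deriv (deriv f) a ≤ g'' := by
  have hm : IsLocalMin (fun t => g t - f t) a := by
    filter_upwards [hmax] with t h
    linarith
  have hd : ∀ᶠ t in 𝓝 a, HasDerivAt (fun t => g t - f t) (g' t - deriv f t) t := by
    filter_upwards [hf, hg] with t h1 h2 using h2.sub h1.hasDerivAt
  have h0 := hm.hasDerivAt_eq_zero hd.self_of_nhds
  have h1 : deriv (fun t => g t - f t) =ᶠ[𝓝 a] fun t => g' t - deriv f t := by
    filter_upwards [hd] with t h using h.deriv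
  have h2 : deriv (deriv (fun t => g t - f t)) a = g'' - deriv (deriv f) a := by
    rw [h1.deriv_eq]; exact (hg2.sub hf2.hasDerivAt).deriv
  have h3 := second_deriv_nonneg hm hd.self_of_nhds.continuousAt
  constructor <;> linarith

/-- second-order jet of a test function at a point -/
structure JetAt (w w1 w2 : ℝ → ℝ → ℝ) (x y w11 w22 : ℝ) : Prop where
  dx : ∀ᶠ t in 𝓝 x, HasDerivAt (fun t => w t y) (w1 t y) t
  dxx : HasDerivAt (fun t => w1 t y) w11 x
  dy : ∀ᶠ t in 𝓝 y, HasDerivAt (fun t => w x t) (w2 x t) t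
  dyy : HasDerivAt (fun t => w2 x t) w22 y

theorem posSet_open {d D μ c : ℝ} {u : ℝ → ℝ → ℝ} (hu : OneSpeciesTW d D μ c u) :
    IsOpen (posSet u ∩ {p : ℝ × ℝ | p.2 < 0}) := by
  obtain ⟨V, hV, h⟩ := hu.relOpen
  have : posSet u ∩ {p : ℝ × ℝ | p.2 < 0} = V ∩ {p : ℝ × ℝ | p.2 < 0} := by
    rw [h]; ext p; simp only [lowerH, mem_inter_iff, mem_ofPred_eq]
    constructor
    · rintro ⟨⟨h1, _⟩, h2⟩; exact ⟨h1, h2⟩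
    · rintro ⟨h1, h2⟩; exact ⟨⟨h1, h2.le⟩, h2⟩
  rw [this]
  exact hV.inter (isOpen_lt continuous_snd continuous_const)

theorem slice_x {d D μ c : ℝ} {u : ℝ → ℝ → ℝ} (hu : OneSpeciesTW d D μ c u) {x y : ℝ}
    (hy : y < 0) (hp : 0 < u x y) : ContDiffAt ℝ 2 (fun t => u t y) x := by
  have hm : (x, y) ∈ posSet u ∩ {p : ℝ × ℝ | p.2 < 0} := ⟨⟨hy.le, hp⟩, hy⟩
  have h := hu.smooth.contDiffAt ((posSet_open hu).mem_nhds hm)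
  have h2 : ContDiffAt ℝ 2 (fun t : ℝ => (t, y)) x := by fun_prop
  exact ContDiffAt.comp (f := fun t : ℝ => (t, y)) x h h2

theorem slice_y {d D μ c : ℝ} {u : ℝ → ℝ → ℝ} (hu : OneSpeciesTW d D μ c u) {x y : ℝ}
    (hy : y < 0) (hp : 0 < u x y) : ContDiffAt ℝ 2 (fun t => u x t) y := by
  have hm : (x, y) ∈ posSet u ∩ {p : ℝ × ℝ | p.2 < 0} := ⟨⟨hy.le, hp⟩, hy⟩
  have h := hu.smooth.contDiffAt ((posSet_open hu).mem_nhds hm)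
  have h2 : ContDiffAt ℝ 2 (fun t : ℝ => (x, t)) y := by fun_prop
  exact ContDiffAt.comp (f := fun t : ℝ => (x, t)) y h h2

theorem c2_facts {f : ℝ → ℝ} {a : ℝ} (h : ContDiffAt ℝ 2 f a) :
    (∀ᶠ t in 𝓝 a, DifferentiableAt ℝ f t) ∧ DifferentiableAt ℝ (deriv f) a := by
  constructor
  · have := h.eventually (by simp)
    filter_upwards [this] with t ht using ht.differentiableAt (by simp)
  · have h1 : ContDiffAt ℝ 1 (deriv f) a := by
      have h2 : ContDiffAt ℝ 1 (fun t => fderiv ℝ f t 1) a :=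
        (h.fderiv_right (m := 1) (by norm_num)).clm_apply contDiffAt_const
      exact h2
    exact h1.differentiableAt (by simp)

theorem interior_below {d D μ c : ℝ} {u : ℝ → ℝ → ℝ} (hd : 0 < d)
    (hu : OneSpeciesTW d D μ c u)
    {w w1 w2 : ℝ → ℝ → ℝ} {x y w11 w22 : ℝ} (hy : y < 0) (hp : 0 < u x y)
    (hj : JetAt w w1 w2 x y w11 w22)
    (hmin : IsLocalMin (fun p : ℝ × ℝ => u p.1 p.2 - w p.1 p.2) (x, y))
    (hs : c * w1 x y < d * (w11 + w22)) : False := by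
  have hx := c2_facts (slice_x hu hy hp)
  have hyy := c2_facts (slice_y hu hy hp)
  have m1 : IsLocalMin (fun t => u t y - w t y) x := by
    have hc : Tendsto (fun t : ℝ => (t, y)) (𝓝 x) (𝓝 (x, y)) :=
      (Continuous.prodMk_left y).tendsto x
    exact hc.eventually hmin
  have m2 : IsLocalMin (fun t => u x t - w x t) y := by
    have hc : Tendsto (fun t : ℝ => (x, t)) (𝓝 y) (𝓝 (x, y)) :=
      (Continuous.prodMk_right x).tendsto y
    exact hc.eventually hmin
  obtain ⟨a1, a2⟩ := touch_below hx.1 hx.2 hj.dx hj.dxx m1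
  obtain ⟨b1, b2⟩ := touch_below hyy.1 hyy.2 hj.dy hj.dyy m2
  have hpde := hu.pde (x, y) ⟨⟨hy.le, hp⟩, hy⟩
  simp only [pdxx, pdyy] at hpde
  have e1 : (fun t => pdx u t y) = deriv (fun t => u t y) := rfl
  have e2 : (fun t => pdy u x t) = deriv (fun t => u x t) := rfl
  rw [e1, e2] at hpde
  have e3 : pdx u x y = w1 x y := a1
  rw [e3] at hpde
  nlinarith

theorem interior_above {d D μ c : ℝ} {u : ℝ → ℝ → ℝ} (hd : 0 < d)
    (hu : OneSpeciesTW d D μ c u)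
    {w w1 w2 : ℝ → ℝ → ℝ} {x y w11 w22 : ℝ} (hy : y < 0) (hp : 0 < u x y)
    (hj : JetAt w w1 w2 x y w11 w22)
    (hmax : IsLocalMax (fun p : ℝ × ℝ => u p.1 p.2 - w p.1 p.2) (x, y))
    (hs : d * (w11 + w22) < c * w1 x y) : False := by
  have hx := c2_facts (slice_x hu hy hp)
  have hyy := c2_facts (slice_y hu hy hp)
  have m1 : IsLocalMax (fun t => u t y - w t y) x := by
    have hc : Tendsto (fun t : ℝ => (t, y)) (𝓝 x) (𝓝 (x, y)) :=
      (Continuous.prodMk_left y).tendsto x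
    exact hc.eventually hmax
  have m2 : IsLocalMax (fun t => u x t - w x t) y := by
    have hc : Tendsto (fun t : ℝ => (x, t)) (𝓝 y) (𝓝 (x, y)) :=
      (Continuous.prodMk_right x).tendsto y
    exact hc.eventually hmax
  obtain ⟨a1, a2⟩ := touch_above hx.1 hx.2 hj.dx hj.dxx m1
  obtain ⟨b1, b2⟩ := touch_above hyy.1 hyy.2 hj.dy hj.dyy m2
  have hpde := hu.pde (x, y) ⟨⟨hy.le, hp⟩, hy⟩
  simp only [pdxx, pdyy] at hpde
  have e1 : (fun t => pdx u t y) = deriv (fun t => u t y) := rfl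
  have e2 : (fun t => pdy u x t) = deriv (fun t => u x t) := rfl
  rw [e1, e2] at hpde
  have e3 : pdx u x y = w1 x y := a1
  rw [e3] at hpde
  nlinarith

theorem left_deriv_nonpos {f : ℝ → ℝ} {a f' : ℝ} (hf : HasDerivAt f f' a)
    (h : ∀ᶠ t in 𝓝[<] a, f a ≤ f t) : f' ≤ 0 := by
  have h1 := hasDerivWithinAt_iff_tendsto_slope' (s := Iio a) (by simp) |>.1
    (hf.hasDerivWithinAt (s := Iio a))
  refine le_of_tendsto h1 ?_
  filter_upwards [h, self_mem_nhdsWithin] with t ht hta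
  have hta' : t - a < 0 := sub_neg.2 hta
  rw [slope_def_field]
  exact div_nonpos_of_nonneg_of_nonpos (by linarith) hta'.le

theorem road_pos_nhds {d D μ c : ℝ} {u : ℝ → ℝ → ℝ} (hu : OneSpeciesTW d D μ c u) {x : ℝ}
    (hp : 0 < u x 0) : ∀ᶠ t in 𝓝 x, 0 < u t 0 := by
  exact (hu.road_diffx x hp).continuousAt.eventually (lt_mem_nhds hp)

theorem road_below {d D μ c : ℝ} {u : ℝ → ℝ → ℝ} (hD : 0 < D) (hμ : 0 < μ)
    (hu : OneSpeciesTW d D μ c u)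
    {w : ℝ → ℝ → ℝ} {w1 : ℝ → ℝ} {x w11 w2 : ℝ} (hp : 0 < u x 0)
    (hdx : ∀ᶠ t in 𝓝 x, HasDerivAt (fun t => w t 0) (w1 t) t)
    (hdxx : HasDerivAt w1 w11 x) (hdy : HasDerivAt (fun t => w x t) w2 0)
    (hmin : ∀ᶠ p in 𝓝[lowerH] (x, (0:ℝ)), u x 0 - w x 0 ≤ u p.1 p.2 - w p.1 p.2)
    (hs : -D * w11 + c * w1 x + (1 / μ) * w2 < 0) : False := by
  have m1 : IsLocalMin (fun t => u t 0 - w t 0) x := by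
    have hc : Tendsto (fun t : ℝ => (t, (0:ℝ))) (𝓝 x) (𝓝[lowerH] (x, 0)) := by
      refine tendsto_nhdsWithin_iff.2 ⟨(Continuous.prodMk_left 0).tendsto x, ?_⟩
      exact Eventually.of_forall fun t => by simp [lowerH]
    exact hc.eventually hmin
  have m2 : ∀ᶠ t in 𝓝[<] (0:ℝ), u x 0 - w x 0 ≤ u x t - w x t := by
    have hc : Tendsto (fun t : ℝ => (x, t)) (𝓝[<] 0) (𝓝[lowerH] (x, 0)) := by
      refine tendsto_nhdsWithin_iff.2
        ⟨((Continuous.prodMk_right x).tendsto 0).mono_left nhdsWithin_le_nhds, ?_⟩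
      filter_upwards [self_mem_nhdsWithin] with t ht
      exact le_of_lt (mem_Iio.1 ht)
    exact hc.eventually hmin
  have hf : ∀ᶠ t in 𝓝 x, DifferentiableAt ℝ (fun t => u t 0) t := by
    filter_upwards [road_pos_nhds hu hp] with t ht using hu.road_diffx t ht
  obtain ⟨a1, a2⟩ := touch_below hf (hu.road_diffxx x hp) hdx hdxx m1
  have b := left_deriv_nonpos ((hu.road_diffy x hp).hasDerivAt.sub hdy) m2
  have hr := hu.road x hp
  have e3 : pdx u x 0 = w1 x := a1
  have e2 : pdxx u x 0 = deriv (deriv fun t => u t 0) x := rfl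
  have e4 : pdy u x 0 = deriv (fun t => u x t) 0 := rfl
  rw [e3, e2, e4] at hr
  have : (1 / μ) * (deriv (fun t => u x t) 0 - w2) ≤ 0 :=
    mul_nonpos_of_nonneg_of_nonpos (by positivity) b
  nlinarith

theorem compare {d D μ c : ℝ} {u : ℝ → ℝ → ℝ} (hd : 0 < d) (hD : 0 < D) (hμ : 0 < μ)
    (hu : OneSpeciesTW d D μ c u) {R : Set (ℝ × ℝ)} (hR : IsCompact R) (hRH : R ⊆ lowerH)
    {w : ℝ → ℝ → ℝ} (hw : ContinuousOn (fun p : ℝ × ℝ => w p.1 p.2) R)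
    (hb : ∀ x y, (x, y) ∈ R → w x y ≤ u x y ∨
      (0 < u x y ∧ y < 0 ∧ R ∈ 𝓝 (x, y) ∧ ∃ w1 w2 w11 w22, JetAt w w1 w2 x y w11 w22 ∧
        c * w1 x y < d * (w11 + w22)) ∨
      (0 < u x 0 ∧ y = 0 ∧ R ∈ 𝓝[lowerH] (x, (0:ℝ)) ∧ ∃ (w1 : ℝ → ℝ) (w11 w2 : ℝ),
        (∀ᶠ t in 𝓝 x, HasDerivAt (fun t => w t 0) (w1 t) t) ∧
        HasDerivAt w1 w11 x ∧ HasDerivAt (fun t => w x t) w2 0 ∧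
        -D * w11 + c * w1 x + (1 / μ) * w2 < 0)) :
    ∀ x y, (x, y) ∈ R → w x y ≤ u x y := by
  intro x y hxy
  obtain ⟨⟨a, b⟩, hab, hmin⟩ := hR.exists_isMinOn ⟨_, hxy⟩ ((hu.cont.mono hRH).sub hw)
  have hle := hmin hxy
  simp only [mem_ofPred_eq, Pi.sub_apply] at hle
  rcases hb a b hab with h | ⟨h1, h2, h3, w1, w2, w11, w22, hj, hs⟩ |
      ⟨h1, h2, h3, w1, w11, w2, hdx, hdxx, hdy, hs⟩
  · linarith
  · exact (interior_below hd hu h2 h1 hj (hmin.isLocalMin h3) hs).elim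
  · subst h2
    exact (road_below hD hμ hu h1 hdx hdxx hdy (by filter_upwards [h3] with p hp using hmin hp) hs).elim

theorem dir_deriv {d D μ c : ℝ} {u : ℝ → ℝ → ℝ} (hu : OneSpeciesTW d D μ c u) {x y e1 e2 s : ℝ}
    (hy : y + s * e2 < 0) (hp : 0 < u (x + s * e1) (y + s * e2)) :
    HasDerivAt (fun s => u (x + s * e1) (y + s * e2))
      (pdx u (x + s * e1) (y + s * e2) * e1 + pdy u (x + s * e1) (y + s * e2) * e2) s := by
  set a := x + s * e1 with ha
  set b := y + s * e2 with hb
  have hm : (a, b) ∈ posSet u ∩ {p : ℝ × ℝ | p.2 < 0} := ⟨⟨hy.le, hp⟩, hy⟩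
  have h := (hu.smooth.contDiffAt ((posSet_open hu).mem_nhds hm)).differentiableAt (by simp)
  have hF := h.hasFDerivAt
  have h1 : HasDerivAt (fun t => u t b) (fderiv ℝ (fun p : ℝ × ℝ => u p.1 p.2) (a, b) (1, 0)) a :=
    HasFDerivAt.comp_hasDerivAt (f := fun t : ℝ => (t, b)) a hF
      ((hasDerivAt_id a).prodMk (hasDerivAt_const a b))
  have h2 : HasDerivAt (fun t => u a t) (fderiv ℝ (fun p : ℝ × ℝ => u p.1 p.2) (a, b) (0, 1)) b :=
    HasFDerivAt.comp_hasDerivAt (f := fun t : ℝ => (a, t)) b hF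
      ((hasDerivAt_const b a).prodMk (hasDerivAt_id b))
  have h3 : HasDerivAt (fun s : ℝ => (x + s * e1, y + s * e2)) (e1, e2) s := by
    apply HasDerivAt.prodMk
    · simpa using ((hasDerivAt_id s).mul_const e1).const_add x
    · simpa using ((hasDerivAt_id s).mul_const e2).const_add y
  have h4 := HasFDerivAt.comp_hasDerivAt (f := fun s : ℝ => (x + s * e1, y + s * e2)) s hF h3
  have e : fderiv ℝ (fun p : ℝ × ℝ => u p.1 p.2) (a, b) (e1, e2)
      = pdx u a b * e1 + pdy u a b * e2 := by
    have : ((e1, e2) : ℝ × ℝ) = e1 • (1, 0) + e2 • (0, 1) := by simp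
    rw [this, map_add, map_smul, map_smul]
    have p1 : pdx u a b = _ := h1.deriv
    have p2 : pdy u a b = _ := h2.deriv
    rw [p1, p2]; simp only [smul_eq_mul]; ring
  rw [← e]; exact h4

theorem no_flat {d D μ c : ℝ} {u : ℝ → ℝ → ℝ} {φ : ℝ → ℝ} (hu : OneSpeciesTW d D μ c u)
    (hΓ : freeBdry u = {p : ℝ × ℝ | ∃ y < (0:ℝ), p = (φ y, y)})
    (hpos : ∀ x y, y < 0 → (0 < u x y ↔ x < φ y))
    {y : ℝ} (hy : y < 0) (hdiff : DifferentiableAt ℝ φ y)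
    (hflat : ∀ᶠ p in 𝓝 (φ y, y), u p.1 p.2 ≤ 1 / 2 * √((p.1 - φ y) ^ 2 + (p.2 - y) ^ 2)) :
    False := by
  obtain ⟨G₁, G₂, hc1, hc2, hG, hone⟩ := hu.grad_ext
  have hmem : (φ y, y) ∈ freeBdry u := by rw [hΓ]; exact ⟨y, hy, rfl⟩
  have h1 := hone _ hmem
  set g1 := G₁ (φ y, y)
  set g2 := G₂ (φ y, y)
  set m := deriv φ y
  have key : ∀ e1 e2 : ℝ, e1 < m * e2 → 0 ≤ g1 * e1 + g2 * e2 ∧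
      g1 * e1 + g2 * e2 ≤ 1 / 2 * √(e1 ^ 2 + e2 ^ 2) := by
    intro e1 e2 he
    set f : ℝ → ℝ := fun s => u (φ y + s * e1) (y + s * e2) with hf
    set S : Set ℝ := {s | 0 < s ∧ y + s * e2 < 0 ∧ φ y + s * e1 < φ (y + s * e2)} with hS
    have hcurve : Tendsto (fun s : ℝ => (φ y + s * e1, y + s * e2)) (𝓝[>] 0) (𝓝 (φ y, y)) := by
      have : Continuous (fun s : ℝ => (φ y + s * e1, y + s * e2)) := by fun_prop
      have := this.tendsto 0
      simp only [zero_mul, add_zero] at this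
      exact this.mono_left nhdsWithin_le_nhds
    have hylt : ∀ᶠ s in 𝓝[>] (0:ℝ), y + s * e2 < 0 := by
      have := (continuous_snd.tendsto (φ y, y)).comp hcurve
      exact this.eventually (gt_mem_nhds hy)
    have hSn : S ∈ 𝓝[>] (0:ℝ) := by
      have hd1 : HasDerivAt (fun s : ℝ => φ (y + s * e2) - (φ y + s * e1)) (m * e2 - e1) 0 := by
        have i1 : HasDerivAt (fun s : ℝ => y + s * e2) e2 0 := by
          simpa using ((hasDerivAt_id (0:ℝ)).mul_const e2).const_add y
        have i2 : HasDerivAt (fun s : ℝ => φ y + s * e1) e1 0 := by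
          simpa using ((hasDerivAt_id (0:ℝ)).mul_const e1).const_add (φ y)
        have i3 : HasDerivAt φ m (y + 0 * e2) := by
          rw [zero_mul, add_zero]; exact hdiff.hasDerivAt
        exact (HasDerivAt.comp (0:ℝ) i3 i1).sub i2
      have hsl := hasDerivWithinAt_iff_tendsto_slope' (s := Ioi (0:ℝ)) (by simp) |>.1
        (hd1.hasDerivWithinAt (s := Ioi 0))
      have hev := hsl.eventually (lt_mem_nhds (show (0:ℝ) < m * e2 - e1 by linarith))
      filter_upwards [hev, hylt, self_mem_nhdsWithin] with s hs1 hs2 hs3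
      have hs3' : 0 < s := hs3
      refine ⟨hs3', hs2, ?_⟩
      rw [slope_def_field] at hs1
      simp only [zero_mul, add_zero, sub_self, sub_zero] at hs1
      have := (div_pos_iff_of_pos_right hs3').1 hs1
      linarith
    have hD : ∀ s ∈ S, HasDerivAt f (pdx u (φ y + s * e1) (y + s * e2) * e1 +
        pdy u (φ y + s * e1) (y + s * e2) * e2) s := fun s hs =>
      dir_deriv hu hs.2.1 ((hpos _ _ hs.2.1).2 hs.2.2)
    have hmemS : ∀ s ∈ S, (φ y + s * e1, y + s * e2) ∈ posSet u ∩ {p : ℝ × ℝ | p.2 < 0} :=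
      fun s hs => ⟨⟨hs.2.1.le, (hpos _ _ hs.2.1).2 hs.2.2⟩, hs.2.1⟩
    have hcw : Tendsto (fun s : ℝ => (φ y + s * e1, y + s * e2)) (𝓝[>] 0)
        (𝓝[posSet u ∪ freeBdry u] (φ y, y)) := by
      refine tendsto_nhdsWithin_iff.2 ⟨hcurve, ?_⟩
      filter_upwards [hSn] with s hs using Or.inl (hmemS s hs).1
    have hlim : Tendsto (fun s => deriv f s) (𝓝[>] 0) (𝓝 (g1 * e1 + g2 * e2)) := by
      have t1 := (hc1 _ (Or.inr hmem)).tendsto.comp hcw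
      have t2 := (hc2 _ (Or.inr hmem)).tendsto.comp hcw
      have t3 := (t1.mul_const e1).add (t2.mul_const e2)
      refine t3.congr' ?_
      filter_upwards [hSn] with s hs
      rw [(hD s hs).deriv]
      have := hG _ (hmemS s hs)
      simp only [Function.comp]
      rw [this.1, this.2]
    have hcont : ContinuousWithinAt f S 0 := by
      have q : ContinuousWithinAt (fun p : ℝ × ℝ => u p.1 p.2) lowerH (φ y, y) :=
        hu.cont _ (show (φ y, y).2 ≤ 0 from hy.le)
      refine ContinuousWithinAt.comp (f := fun s : ℝ => (φ y + s * e1, y + s * e2))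
        (g := fun p : ℝ × ℝ => u p.1 p.2) (t := lowerH) (by simpa only [zero_mul, add_zero] using q) ?_ ?_
      · exact (by fun_prop : Continuous (fun s : ℝ => (φ y + s * e1, y + s * e2))).continuousWithinAt
      · intro s hs; exact hs.2.1.le
    have hder := hasDerivWithinAt_Ici_of_tendsto_deriv (s := S)
      (fun s hs => (hD s hs).differentiableAt.differentiableWithinAt) hcont hSn hlim
    have hsl := hasDerivWithinAt_iff_tendsto_slope.1 hder
    have hsl' : Tendsto (slope f 0) (𝓝[>] 0) (𝓝 (g1 * e1 + g2 * e2)) := by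
      refine hsl.mono_left (nhdsWithin_mono _ ?_)
      intro s hs; exact ⟨mem_Ici.2 (le_of_lt (mem_Ioi.1 hs)), ne_of_gt (mem_Ioi.1 hs)⟩
    have f0 : f 0 = 0 := by
      have hn : ¬ (0 < u (φ y) y) := by rw [hpos _ _ hy]; simp
      have := (hu.mem01 (φ y) y hy.le).1
      simp only [hf, zero_mul, add_zero]; linarith
    constructor
    · refine ge_of_tendsto hsl' ?_
      filter_upwards [hSn] with s hs
      rw [slope_def_field, f0]
      have := (hu.mem01 (φ y + s * e1) (y + s * e2) hs.2.1.le).1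
      exact div_nonneg (by simpa [hf] using this) (by linarith [hs.1])
    · refine le_of_tendsto hsl' ?_
      filter_upwards [hSn, hcurve.eventually hflat] with s hs hs2
      rw [slope_def_field, f0, sub_zero, sub_zero, div_le_iff₀ hs.1]
      simp only [add_sub_cancel_left] at hs2
      have e : (s * e1) ^ 2 + (s * e2) ^ 2 = s ^ 2 * (e1 ^ 2 + e2 ^ 2) := by ring
      rw [e, Real.sqrt_mul (sq_nonneg s), Real.sqrt_sq hs.1.le] at hs2
      simp only [hf]; nlinarith
  have t1 : 0 ≤ g1 * m + g2 := by
    by_contra hlt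
    push Not at hlt
    set A := |(-g1 + m * g2)| + 1
    have hA : 0 < A := by positivity
    set ε := -(g1 * m + g2) / (2 * A)
    have hε : 0 < ε := by apply div_pos <;> linarith
    have := (key (m - ε) (1 + ε * m) (by nlinarith [sq_nonneg m])).1
    have e : ε * A = -(g1 * m + g2) / 2 := by
      simp only [ε]; field_simp
    have : ε * (-g1 + m * g2) ≤ ε * A := by
      apply mul_le_mul_of_nonneg_left _ hε.le
      have := le_abs_self (-g1 + m * g2); simp only [A]; linarith
    nlinarith
  have t2 : g1 * m + g2 ≤ 0 := by
    by_contra hlt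
    push Not at hlt
    set A := |(-g1 + m * g2)| + 1
    have hA : 0 < A := by positivity
    set ε := (g1 * m + g2) / (2 * A)
    have hε : 0 < ε := by apply div_pos <;> linarith
    have := (key (-m - ε) (-1 + ε * m) (by nlinarith [sq_nonneg m])).1
    have e : ε * A = (g1 * m + g2) / 2 := by
      simp only [ε]; field_simp
    have : ε * (-g1 + m * g2) ≤ ε * A := by
      apply mul_le_mul_of_nonneg_left _ hε.le
      have := le_abs_self (-g1 + m * g2); simp only [A]; linarith
    nlinarith
  have hg2 : g2 = -(g1 * m) := by linarith
  have hn := (key (-1) m (by nlinarith [sq_nonneg m])).1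
  have hg1 : g1 < 0 := by
    have : g1 ≤ 0 := by
      by_contra hh; push Not at hh
      rw [hg2] at hn
      nlinarith [sq_nonneg m, mul_nonneg hh.le (sq_nonneg m)]
    rcases this.lt_or_eq with h | h
    · exact h
    · rw [hg2, h] at h1; norm_num at h1
  have hlast := (key g1 g2 (by rw [hg2]; nlinarith [mul_nonneg (neg_pos.2 hg1).le (sq_nonneg m)])).2
  rw [h1] at hlast
  simp at hlast
  nlinarith

/-- collected facts -/
structure Ctx (d D μ c K : ℝ) (u : ℝ → ℝ → ℝ) (φ : ℝ → ℝ) : Prop where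
  hd : 0 < d
  hD : 0 < D
  hμ : 0 < μ
  hK : 1 ≤ K
  tw : OneSpeciesTW d D μ c u
  lip : ∀ x y x' y', y ≤ 0 → y' ≤ 0 → |u x y - u x' y'| ≤ K * max |x - x'| |y - y'|
  hφ : ContinuousOn φ (Iio 0)
  gam : freeBdry u = {p : ℝ × ℝ | ∃ y < (0:ℝ), p = (φ y, y)}
  pos : ∀ x y, y < 0 → (0 < u x y ↔ x < φ y)
  mono : ∀ x y, y ≤ 0 → 0 < u x y → pdx u x y < 0
  down : ∀ x x' y, y ≤ 0 → x ≤ x' → 0 < u x' y → 0 < u x y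
  anti : ∀ x x' y, y ≤ 0 → x ≤ x' → u x' y ≤ u x y
  flat : ∀ y < (0:ℝ), ¬ ∀ᶠ p in 𝓝 (φ y, y),
    u p.1 p.2 ≤ 1 / 2 * √((p.1 - φ y) ^ 2 + (p.2 - y) ^ 2)

theorem mk_ctx {d D μ c : ℝ} {u : ℝ → ℝ → ℝ} {φ : ℝ → ℝ} (hd : 0 < d) (hD : 0 < D) (hμ : 0 < μ)
    (hu : OneSpeciesTW d D μ c u)
    (hLip : ∃ K : NNReal, LipschitzOnWith K (fun p : ℝ × ℝ => u p.1 p.2) lowerH)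
    (hmono : ∀ p ∈ posSet u, pdx u p.1 p.2 < 0)
    (hφa : AnalyticOnNhd ℝ φ (Iio 0))
    (hΓ : freeBdry u = {p : ℝ × ℝ | ∃ y < (0:ℝ), p = (φ y, y)}) :
    ∃ K, Ctx d D μ c K u φ := by
  obtain ⟨K, hK⟩ := hLip
  have hm : ∀ x y, y ≤ 0 → 0 < u x y → pdx u x y < 0 := fun x y hy hp => hmono (x, y) ⟨hy, hp⟩
  have hsl : ∀ y ≤ (0:ℝ), Continuous (fun t => u t y) := by
    intro y hy
    rw [← continuousOn_univ]
    exact hu.cont.comp (f := fun t : ℝ => (t, y)) (by fun_prop) (fun t _ => hy)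
  -- strict decrease on positive intervals
  have hanti0 : ∀ x x' y, y ≤ 0 → x ≤ x' → (∀ t ∈ Ioo x x', 0 < u t y) → u x' y ≤ u x y := by
    intro x x' y hy hxx hp
    have : AntitoneOn (fun t => u t y) (Icc x x') := by
      apply antitoneOn_of_deriv_nonpos (convex_Icc x x') (hsl y hy).continuousOn
      · rw [interior_Icc]
        intro t ht
        have : deriv (fun t => u t y) t < 0 := hm t y hy (hp t ht)
        exact (differentiableAt_of_deriv_ne_zero this.ne).differentiableWithinAt
      · rw [interior_Icc]
        intro t ht
        have : deriv (fun t => u t y) t < 0 := hm t y hy (hp t ht)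
        exact this.le
    exact this (left_mem_Icc.2 hxx) (right_mem_Icc.2 hxx) hxx
  have hdown : ∀ x x' y, y ≤ 0 → x ≤ x' → 0 < u x' y → 0 < u x y := by
    intro x x' y hy hxx hp
    by_contra hn
    have hz : u x y = 0 := le_antisymm (not_lt.1 hn) (hu.mem01 x y hy).1
    set Z := Icc x x' ∩ {t | u t y = 0} with hZ
    have hZc : IsCompact Z := isCompact_Icc.inter_right (isClosed_eq (hsl y hy) continuous_const)
    obtain ⟨z, hz1, hz2⟩ := hZc.exists_isGreatest ⟨x, ⟨left_mem_Icc.2 hxx, hz⟩⟩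
    have := hanti0 z x' y hy hz1.1.2 (by
      intro t ht
      rcases (hu.mem01 t y hy).1.lt_or_eq with h | h
      · exact h
      · have := hz2 ⟨⟨hz1.1.1.trans ht.1.le, ht.2.le⟩, h.symm⟩
        exact absurd ht.1 (not_lt.2 this))
    have hz0 : u z y = 0 := hz1.2
    linarith
  have hanti : ∀ x x' y, y ≤ 0 → x ≤ x' → u x' y ≤ u x y := by
    intro x x' y hy hxx
    rcases (hu.mem01 x' y hy).1.lt_or_eq with h | h
    · exact hanti0 x x' y hy hxx (fun t ht => hdown t x' y hy ht.2.le h)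
    · rw [← h]; exact (hu.mem01 x y hy).1
  have hΓ0 : ∀ y < (0:ℝ), ¬ 0 < u (φ y) y := by
    intro y hy hp
    have hmem : (φ y, y) ∈ freeBdry u := by rw [hΓ]; exact ⟨y, hy, rfl⟩
    have hin : (φ y, y) ∈ posSet u ∩ {p : ℝ × ℝ | p.2 < 0} := ⟨⟨hy.le, hp⟩, hy⟩
    have : (φ y, y) ∈ interior (posSet u) :=
      interior_maximal inter_subset_left (posSet_open hu) hin
    exact hmem.1.2 this
  have hpos : ∀ x y, y < 0 → (0 < u x y ↔ x < φ y) := by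
    intro x y hy
    constructor
    · intro hp
      by_contra hn
      exact hΓ0 y hy (hdown _ _ y hy.le (not_lt.1 hn) hp)
    · intro hx
      by_contra hn
      have hz : u x y = 0 := le_antisymm (not_lt.1 hn) (hu.mem01 x y hy.le).1
      obtain ⟨M, hM⟩ := hu.lim_left (1/2) (by norm_num)
      set Z := {t | u t y = 0} with hZ
      have hZcl : IsClosed Z := isClosed_eq (hsl y hy.le) continuous_const
      have hbd : ∀ t ∈ Z, M < t := by
        intro t ht
        by_contra hh
        have := hM t (not_lt.1 hh) y hy.le
        have ht' : u t y = 0 := ht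
        rw [ht', abs_lt] at this
        linarith [this.1]
      have hbb : BddBelow Z := ⟨M, fun t ht => (hbd t ht).le⟩
      have hI : sInf Z ∈ Z := hZcl.csInf_mem ⟨x, hz⟩ hbb
      set X := sInf Z
      have hXx : X ≤ x := csInf_le hbb hz
      have hXz : u X y = 0 := hI
      have hfr : (X, y) ∈ freeBdry u := by
        refine ⟨⟨?_, ?_⟩, hy⟩
        · have hc : Tendsto (fun t : ℝ => (t, y)) (𝓝[<] X) (𝓝 (X, y)) :=
            ((Continuous.prodMk_left y).tendsto X).mono_left nhdsWithin_le_nhds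
          refine mem_closure_of_tendsto hc ?_
          filter_upwards [self_mem_nhdsWithin] with t ht
          refine ⟨hy.le, ?_⟩
          rcases (hu.mem01 t y hy.le).1.lt_or_eq with h | h
          · exact h
          · exact absurd (csInf_le hbb h.symm) (not_le.2 ht)
        · intro hin
          have := interior_subset hin
          have h2 : 0 < u X y := this.2
          linarith
      rw [hΓ] at hfr
      obtain ⟨y', _, he⟩ := hfr
      have e2 : y = y' := (Prod.ext_iff.1 he).2
      have e1 : X = φ y' := (Prod.ext_iff.1 he).1
      rw [← e2] at e1
      linarith
  refine ⟨K + 1, hd, hD, hμ, by simp, hu, ?_, hφa.continuousOn, hΓ, hpos, hm,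
    hdown, hanti, ?_⟩
  · intro x y x' y' hy hy'
    have := hK.dist_le_mul (x, y) hy (x', y') hy'
    rw [Real.dist_eq, Prod.dist_eq, Real.dist_eq, Real.dist_eq] at this
    refine this.trans ?_
    apply mul_le_mul_of_nonneg_right (by linarith)
    positivity
  · intro y hy hfl
    exact no_flat hu hΓ hpos hy (hφa y hy).differentiableAt hfl

theorem inv_deriv_aux {A B k a t : ℝ} (h : (t - a) ^ 2 + k ≠ 0) :
    HasDerivAt (fun t => A + B / ((t - a) ^ 2 + k)) (-(B * (2 * (t - a))) / ((t - a) ^ 2 + k) ^ 2) t := by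
  have h1 : HasDerivAt (fun t => (t - a) ^ 2 + k) (2 * (t - a)) t := by
    have := (((hasDerivAt_id t).sub_const a).pow 2).add_const k
    simpa using this
  have h2 : HasDerivAt (fun t => A + B / ((t - a) ^ 2 + k)) _ t :=
    ((hasDerivAt_const t B).div h1 h).const_add A
  exact h2.congr_deriv (by ring)

theorem inv_deriv2_aux {B k a t : ℝ} (h : (t - a) ^ 2 + k ≠ 0) :
    HasDerivAt (fun t => -(B * (2 * (t - a))) / ((t - a) ^ 2 + k) ^ 2)
      (-(2 * B) / ((t - a) ^ 2 + k) ^ 2 + 8 * B * (t - a) ^ 2 / ((t - a) ^ 2 + k) ^ 3) t := by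
  have h1 : HasDerivAt (fun t => (t - a) ^ 2 + k) (2 * (t - a)) t := by
    have := (((hasDerivAt_id t).sub_const a).pow 2).add_const k
    simpa using this
  have h3 : HasDerivAt (fun t => -(B * (2 * (t - a)))) _ t :=
    ((((hasDerivAt_id t).sub_const a).const_mul 2).const_mul B).neg
  have h4 : HasDerivAt (fun t => ((t - a) ^ 2 + k) ^ 2) _ t := h1.pow 2
  have h2 : HasDerivAt (fun t => -(B * (2 * (t - a))) / ((t - a) ^ 2 + k) ^ 2) _ t :=
    h3.div h4 (pow_ne_zero 2 h)
  refine h2.congr_deriv ?_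
  norm_num
  field_simp
  ring

theorem dot_le {a b c d p q : ℝ} (hp : 0 ≤ p) (hq : 0 ≤ q) (h1 : a ^ 2 + b ^ 2 ≤ p ^ 2)
    (h2 : c ^ 2 + d ^ 2 ≤ q ^ 2) : a * c + b * d ≤ p * q := by
  apply le_of_abs_le
  apply abs_le_of_sq_le_sq _ (by positivity)
  have i1 : (a ^ 2 + b ^ 2) * (c ^ 2 + d ^ 2) ≤ p ^ 2 * q ^ 2 :=
    mul_le_mul h1 h2 (by positivity) (by positivity)
  have i2 : (a * c + b * d) ^ 2 + (a * d - b * c) ^ 2 = (a ^ 2 + b ^ 2) * (c ^ 2 + d ^ 2) := by ring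
  have i3 := sq_nonneg (a * d - b * c)
  rw [mul_pow]
  linarith

theorem sum_sq_le {a b c d p q : ℝ} (hp : 0 ≤ p) (hq : 0 ≤ q) (h1 : a ^ 2 + b ^ 2 ≤ p ^ 2)
    (h2 : c ^ 2 + d ^ 2 ≤ q ^ 2) : (a + c) ^ 2 + (b + d) ^ 2 ≤ (p + q) ^ 2 := by
  have := dot_le hp hq h1 h2
  have e : (a + c) ^ 2 + (b + d) ^ 2 = (a ^ 2 + b ^ 2) + (c ^ 2 + d ^ 2) + 2 * (a * c + b * d) := by ring
  have e2 : (p + q) ^ 2 = p ^ 2 + q ^ 2 + 2 * (p * q) := by ring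
  rw [e, e2]; linarith

theorem slide_poly {ρ δ q U : ℝ} (hρ : 0 < ρ) (hδ0 : 0 ≤ δ) (hq0 : 0 ≤ q)
    (hq' : q ≤ (δ + ρ / 2) ^ 2) (s1 : U * q ≤ ρ / 8 * q - ρ ^ 3 / 32) :
    U ≤ 1 / 2 * δ := by
  by_contra hh
  push Not at hh
  have hρ3 : 0 < ρ ^ 3 := by positivity
  have hq3 : 0 < q := by
    rcases hq0.lt_or_eq with h | h
    · exact h
    · rw [← h] at s1; linarith
  have a0 : (1 / 2 * δ) * q < U * q := mul_lt_mul_of_pos_right hh hq3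
  have a1 : ρ ^ 3 / 32 < q * (ρ / 8 - δ / 2) := by linarith
  have a2 : 0 < ρ / 8 - δ / 2 := by
    by_contra hn
    push Not at hn
    have := mul_nonneg hq0 (neg_nonneg.2 hn)
    linarith
  have a3 : q * (ρ / 8 - δ / 2) ≤ (δ + ρ / 2) ^ 2 * (ρ / 8 - δ / 2) :=
    mul_le_mul_of_nonneg_right hq' a2.le
  have e : (δ + ρ / 2) ^ 2 * (ρ / 8 - δ / 2) = ρ ^ 3 / 32 - 3 / 8 * (δ ^ 2 * ρ) - δ ^ 3 / 2 := by ring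
  have p1 : 0 ≤ δ ^ 2 * ρ := by positivity
  have p2 : 0 ≤ δ ^ 3 := by positivity
  linarith

theorem jet_inv {A B a b x y : ℝ} (h : (x - a) ^ 2 + (y - b) ^ 2 ≠ 0) :
    JetAt (fun x y => A + B / ((x - a) ^ 2 + (y - b) ^ 2))
      (fun x y => -(B * (2 * (x - a))) / ((x - a) ^ 2 + (y - b) ^ 2) ^ 2)
      (fun x y => -(B * (2 * (y - b))) / ((x - a) ^ 2 + (y - b) ^ 2) ^ 2) x y
      (-(2 * B) / ((x - a) ^ 2 + (y - b) ^ 2) ^ 2 + 8 * B * (x - a) ^ 2 / ((x - a) ^ 2 + (y - b) ^ 2) ^ 3)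
      (-(2 * B) / ((x - a) ^ 2 + (y - b) ^ 2) ^ 2 + 8 * B * (y - b) ^ 2 / ((x - a) ^ 2 + (y - b) ^ 2) ^ 3) where
  dx := by
    have hc : ContinuousAt (fun t : ℝ => (t - a) ^ 2 + (y - b) ^ 2) x := by fun_prop
    filter_upwards [hc.eventually_ne h] with t ht using inv_deriv_aux ht
  dxx := inv_deriv2_aux h
  dy := by
    have hc : ContinuousAt (fun t : ℝ => (x - a) ^ 2 + (t - b) ^ 2) y := by fun_prop
    filter_upwards [hc.eventually_ne h] with t ht
    have := inv_deriv_aux (A := A) (B := B) (k := (x - a) ^ 2) (a := b) (t := t) (by rwa [add_comm])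
    simp only [add_comm ((x - a) ^ 2)]
    exact this
  dyy := by
    have := inv_deriv2_aux (B := B) (k := (x - a) ^ 2) (a := b) (t := y) (by rwa [add_comm])
    simp only [add_comm ((x - a) ^ 2)]
    exact this

theorem lap_inv {B X Y : ℝ} (h : X ^ 2 + Y ^ 2 ≠ 0) :
    (-(2 * B) / (X ^ 2 + Y ^ 2) ^ 2 + 8 * B * X ^ 2 / (X ^ 2 + Y ^ 2) ^ 3) +
    (-(2 * B) / (X ^ 2 + Y ^ 2) ^ 2 + 8 * B * Y ^ 2 / (X ^ 2 + Y ^ 2) ^ 3)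
      = 4 * B / (X ^ 2 + Y ^ 2) ^ 2 := by
  field_simp
  ring

set_option maxHeartbeats 1000000 in
theorem slide {d D μ c K : ℝ} {u : ℝ → ℝ → ℝ} {φ : ℝ → ℝ} (C : Ctx d D μ c K u φ) {x0 y0 ρ : ℝ}
    (hρ : 0 < ρ) (hy : y0 + ρ < 0) (hb : c * ρ < 2 * d) (hp : 0 < u x0 y0) :
    ∃ x y, (x - x0) ^ 2 + (y - y0) ^ 2 ≤ ρ ^ 2 ∧ 3 * ρ / 32 ≤ u x y := by
  by_contra hcon
  push Not at hcon
  have hc0 := C.tw.c_pos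
  have hsm : ∀ t x y, x0 ≤ t → (x - t) ^ 2 + (y - y0) ^ 2 ≤ ρ ^ 2 → u x y < 3 * ρ / 32 := by
    intro t x y ht hq
    have hyy : y ≤ 0 := by
      have : |y - y0| ≤ ρ := abs_le_of_sq_le_sq (by nlinarith [sq_nonneg (x - t)]) hρ.le
      linarith [(abs_le.1 this).2]
    refine lt_of_le_of_lt (C.anti (x - (t - x0)) x y hyy (by linarith)) (hcon _ _ ?_)
    have : x - (t - x0) - x0 = x - t := by ring
    rw [this]; exact hq
  obtain ⟨Φ, hΦ⟩ : ∃ Φ, ∀ y ∈ Icc (y0 - ρ) (y0 + ρ), φ y ≤ Φ := by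
    have hcomp := (isCompact_Icc (a := y0 - ρ) (b := y0 + ρ)).bddAbove_image
      (C.hφ.mono (fun y hy' => lt_of_le_of_lt hy'.2 hy))
    obtain ⟨Φ, h⟩ := hcomp
    exact ⟨Φ, fun y hy' => h ⟨y, hy', rfl⟩⟩
  have hyb : ∀ t x y : ℝ, (x - t) ^ 2 + (y - y0) ^ 2 ≤ ρ ^ 2 →
      y ∈ Icc (y0 - ρ) (y0 + ρ) ∧ |x - t| ≤ ρ := by
    intro t x y hq
    have : |y - y0| ≤ ρ := abs_le_of_sq_le_sq (by nlinarith [sq_nonneg (x - t)]) hρ.le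
    have h2 : |x - t| ≤ ρ := abs_le_of_sq_le_sq (by nlinarith [sq_nonneg (y - y0)]) hρ.le
    have := abs_le.1 this
    exact ⟨⟨by linarith, by linarith⟩, h2⟩
  set Bx : Set (ℝ × ℝ × ℝ) := Icc x0 (Φ + ρ) ×ˢ Icc (x0 - ρ) Φ ×ˢ Icc (y0 - ρ) (y0 + ρ) with hBx
  have hBc : IsCompact Bx := isCompact_Icc.prod (isCompact_Icc.prod isCompact_Icc)
  set Q : ℝ × ℝ × ℝ → ℝ := fun p => (p.2.1 - p.1) ^ 2 + (p.2.2 - y0) ^ 2 with hQ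
  have hQc : Continuous Q := by fun_prop
  set S : Set (ℝ × ℝ × ℝ) := {p | p ∈ Bx ∧ (Q p ≤ ρ ^ 2 ∧ p.2.1 ≤ φ p.2.2 ∧
    ρ / 8 * Q p - ρ ^ 3 / 32 ≤ u p.2.1 p.2.2 * Q p)} with hS
  have hScomp : IsCompact S := by
    have k1 : IsClosed {p | p ∈ Bx ∧ Q p ≤ ρ ^ 2} :=
      hBc.isClosed.isClosed_le hQc.continuousOn continuousOn_const
    have k2 : IsClosed {p | p ∈ Bx ∧ p.2.1 ≤ φ p.2.2} := by
      refine hBc.isClosed.isClosed_le (by fun_prop) ?_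
      refine C.hφ.comp (f := fun p : ℝ × ℝ × ℝ => p.2.2) (by fun_prop) ?_
      intro p hp'
      exact lt_of_le_of_lt hp'.2.2.2 hy
    have k3 : IsClosed {p | p ∈ Bx ∧ ρ / 8 * Q p - ρ ^ 3 / 32 ≤ u p.2.1 p.2.2 * Q p} := by
      refine hBc.isClosed.isClosed_le (by fun_prop) ?_
      refine ContinuousOn.mul ?_ hQc.continuousOn
      refine C.tw.cont.comp (f := fun p : ℝ × ℝ × ℝ => p.2) (by fun_prop) ?_
      intro p hp'
      exact le_of_lt (lt_of_le_of_lt hp'.2.2.2 hy)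
    have : S = Bx ∩ ({p | p ∈ Bx ∧ Q p ≤ ρ ^ 2} ∩ ({p | p ∈ Bx ∧ p.2.1 ≤ φ p.2.2} ∩
        {p | p ∈ Bx ∧ ρ / 8 * Q p - ρ ^ 3 / 32 ≤ u p.2.1 p.2.2 * Q p})) := by
      ext p
      simp only [hS, mem_inter_iff, mem_ofPred_eq]
      tauto
    rw [this]
    exact hBc.inter_right (k1.inter (k2.inter k3))
  have hmemS : ∀ t x y, x0 ≤ t → (x - t) ^ 2 + (y - y0) ^ 2 ≤ ρ ^ 2 → x ≤ φ y →
      ρ / 8 * ((x - t) ^ 2 + (y - y0) ^ 2) - ρ ^ 3 / 32 ≤ u x y * ((x - t) ^ 2 + (y - y0) ^ 2) →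
      (t, x, y) ∈ S := by
    intro t x y ht hq hx hu'
    obtain ⟨i1, i2⟩ := hyb t x y hq
    have i3 := hΦ y i1
    have i4 := abs_le.1 i2
    exact ⟨⟨⟨ht, by dsimp only; linarith⟩, ⟨⟨by dsimp only; linarith, by dsimp only; linarith⟩, i1⟩⟩, hq, hx, hu'⟩
  have hy0 : y0 < 0 := by linarith
  have hne : S.Nonempty := ⟨(x0, x0, y0), hmemS x0 x0 y0 le_rfl (by simp; positivity)
    ((C.pos _ _ hy0).1 hp).le (by simp; positivity)⟩
  obtain ⟨⟨t, x, y⟩, hmem, hmax⟩ := hScomp.exists_isMaxOn hne continuous_fst.continuousOn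
  obtain ⟨hbx, hq, hxφ, hu1⟩ := hmem
  have ht0 : x0 ≤ t := hbx.1.1
  simp only [hQ] at hq hxφ hu1
  have hyneg : y < 0 := lt_of_le_of_lt (hyb t x y hq).1.2 hy
  have star : ∀ x' y', x' < φ y' → (x' - t) ^ 2 + (y' - y0) ^ 2 < ρ ^ 2 →
      u x' y' * ((x' - t) ^ 2 + (y' - y0) ^ 2) ≤
        ρ / 8 * ((x' - t) ^ 2 + (y' - y0) ^ 2) - ρ ^ 3 / 32 := by
    intro x' y' hx' hq'
    by_contra hlt
    push Not at hlt
    have c1 : ContinuousAt (fun τ : ℝ => (x' - τ) ^ 2 + (y' - y0) ^ 2) t := by fun_prop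
    have c2 : ContinuousAt (fun τ : ℝ => ρ / 8 * ((x' - τ) ^ 2 + (y' - y0) ^ 2) - ρ ^ 3 / 32 -
      u x' y' * ((x' - τ) ^ 2 + (y' - y0) ^ 2)) t := by fun_prop
    have e1 := c1.eventually (gt_mem_nhds hq')
    have e2 := c2.eventually (gt_mem_nhds (sub_neg.2 hlt))
    have e3 := (e1.and e2).filter_mono (nhdsWithin_le_nhds (s := Ioi t))
    obtain ⟨τ, ⟨h1, h2⟩, h3⟩ := (e3.and self_mem_nhdsWithin).exists
    have h3' : t < τ := h3
    have := hmax (hmemS τ x' y' (by linarith) h1.le hx'.le (by linarith))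
    simp only [mem_ofPred_eq] at this
    linarith
  have hqlt : (x - t) ^ 2 + (y - y0) ^ 2 < ρ ^ 2 := by
    rcases hq.lt_or_eq with h | h
    · exact h
    · exfalso
      have := hsm t x y ht0 hq
      rw [h] at hu1
      have h2 : ρ ^ 2 * (3 * ρ / 32 - u x y) ≤ 0 := by nlinarith
      have h3 : 0 < ρ ^ 2 * (3 * ρ / 32 - u x y) := mul_pos (by positivity) (by linarith)
      linarith
  have hqc : ContinuousAt (fun p : ℝ × ℝ => (p.1 - t) ^ 2 + (p.2 - y0) ^ 2) (x, y) := by fun_prop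
  rcases hxφ.lt_or_eq with hlt | heq
  · have hup := (C.pos x y hyneg).2 hlt
    have hst := star x y hlt hqlt
    set q := (x - t) ^ 2 + (y - y0) ^ 2 with hqdef
    have hq0 : 0 < q := by
      have : 0 ≤ q := by positivity
      rcases this.lt_or_eq with h | h
      · exact h
      · rw [← h] at hst
        have : 0 < ρ ^ 3 := by positivity
        linarith
    refine interior_above C.hd C.tw hyneg hup
      (jet_inv (A := ρ / 8) (B := -(ρ ^ 3 / 32)) (a := t) (b := y0) hq0.ne') ?_ ?_
    · have hopen := (posSet_open C.tw).mem_nhds (show (x, y) ∈ _ from ⟨⟨hyneg.le, hup⟩, hyneg⟩)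
      filter_upwards [hopen, hqc.eventually (gt_mem_nhds hqlt), hqc.eventually (lt_mem_nhds hq0)] with p h1 h2 h3
      have s1 := star p.1 p.2 ((C.pos _ _ h1.2).1 h1.1.2) h2
      have i1 : u p.1 p.2 ≤ ρ / 8 + -(ρ ^ 3 / 32) / ((p.1 - t) ^ 2 + (p.2 - y0) ^ 2) := by
        rw [show ρ / 8 + -(ρ ^ 3 / 32) / ((p.1 - t) ^ 2 + (p.2 - y0) ^ 2) =
          (ρ / 8 * ((p.1 - t) ^ 2 + (p.2 - y0) ^ 2) - ρ ^ 3 / 32) / ((p.1 - t) ^ 2 + (p.2 - y0) ^ 2) by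
            field_simp; ring]
        rw [le_div_iff₀ h3]; exact s1
      have i2 : ρ / 8 + -(ρ ^ 3 / 32) / q ≤ u x y := by
        rw [show ρ / 8 + -(ρ ^ 3 / 32) / q = (ρ / 8 * q - ρ ^ 3 / 32) / q by field_simp; ring]
        rw [div_le_iff₀ hq0]; exact hu1
      simp only [← hqdef]
      linarith
    · rw [lap_inv hq0.ne', ← hqdef]
      have hx2 := abs_le.1 (hyb t x y hq).2
      rw [← sub_pos]
      have : c * (-(-(ρ ^ 3 / 32) * (2 * (x - t))) / q ^ 2) - d * (4 * -(ρ ^ 3 / 32) / q ^ 2)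
        = (ρ ^ 3 / 16) * (c * (x - t) + 2 * d) / q ^ 2 := by field_simp; ring
      rw [this]
      have h3 : 0 < c * (x - t) + 2 * d := by nlinarith
      positivity
  · have hu0 : u x y = 0 := by
      have hn : ¬ 0 < u x y := by rw [C.pos _ _ hyneg]; linarith
      exact le_antisymm (not_lt.1 hn) (C.tw.mem01 x y hyneg.le).1
    rw [hu0, zero_mul] at hu1
    have hqq : (x - t) ^ 2 + (y - y0) ^ 2 ≤ (ρ / 2) ^ 2 := by
      by_contra hh
      push Not at hh
      nlinarith
    refine C.flat y hyneg ?_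
    rw [← heq]
    have hyev : ∀ᶠ p : ℝ × ℝ in 𝓝 (x, y), p.2 < 0 :=
      continuous_snd.continuousAt.eventually (gt_mem_nhds hyneg)
    filter_upwards [hyev, hqc.eventually (gt_mem_nhds hqlt)] with p h1 h2
    obtain ⟨x', y'⟩ := p
    dsimp only at h1 h2 ⊢
    rcases (C.tw.mem01 x' y' h1.le).1.lt_or_eq with hpos | hz
    swap
    · rw [← hz]; positivity
    have s1 := star x' y' ((C.pos _ _ h1).1 hpos) h2
    set δ := √((x' - x) ^ 2 + (y' - y) ^ 2) with hδ
    have hδ0 : 0 ≤ δ := Real.sqrt_nonneg _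
    have hδ2 : δ ^ 2 = (x' - x) ^ 2 + (y' - y) ^ 2 := Real.sq_sqrt (by positivity)
    have hq' : (x' - t) ^ 2 + (y' - y0) ^ 2 ≤ (δ + ρ / 2) ^ 2 := by
      have := sum_sq_le hδ0 (by positivity) hδ2.ge hqq
      rwa [show x' - x + (x - t) = x' - t by ring, show y' - y + (y - y0) = y' - y0 by ring] at this
    exact slide_poly hρ hδ0 (by positivity) hq' s1

set_option maxHeartbeats 1000000 in
theorem interior_est {d D μ c K : ℝ} {u : ℝ → ℝ → ℝ} {φ : ℝ → ℝ} (C : Ctx d D μ c K u φ) :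
    ∃ κ > 0, κ ≤ 1 ∧ ∃ r0 > 0, ∀ x y s : ℝ, 0 < s → s ≤ r0 → y + s ≤ 0 →
      (∀ x' y', (x' - x) ^ 2 + (y' - y) ^ 2 < s ^ 2 → 0 < u x' y') → κ * s ≤ u x y := by
  have hc0 := C.tw.c_pos
  have hd := C.hd
  have hK := C.hK
  have hK0 : 0 < K := by linarith
  set θ : ℝ := 3 / (256 * K) with hθ
  have hθ0 : 0 < θ := by positivity
  have hθ1 : θ ≤ 3 / 256 := by
    rw [hθ]; apply div_le_div_of_nonneg_left <;> linarith
  have hKθ : K * θ = 3 / 256 := by rw [hθ]; field_simp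
  refine ⟨θ ^ 2 / 6, by positivity, by nlinarith, d / c, by positivity, ?_⟩
  intro x y s hs hs1 hys hΩ
  have hcs : c * s ≤ d := by rw [le_div_iff₀ hc0] at hs1; linarith
  obtain ⟨a, b, hab, hub⟩ := slide C (x0 := x) (y0 := y) (ρ := s / 4) (by positivity) (by linarith)
    (by nlinarith) (hΩ x y (by simp; positivity))
  have hbabs : |b - y| ≤ s / 4 := abs_le_of_sq_le_sq (by nlinarith [sq_nonneg (a - x)]) (by positivity)
  have hb1 := abs_le.1 hbabs
  have hb0 : b ≤ 0 := by linarith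
  have hnear : ∀ x' y', y' ≤ 0 → (x' - a) ^ 2 + (y' - b) ^ 2 ≤ (θ * s) ^ 2 → 3 * s / 256 ≤ u x' y' := by
    intro x' y' hy' hq
    have i1 : |a - x'| ≤ θ * s := by
      rw [abs_sub_comm]
      exact abs_le_of_sq_le_sq (by nlinarith [sq_nonneg (y' - b)]) (by positivity)
    have i2 : |b - y'| ≤ θ * s := by
      rw [abs_sub_comm]
      exact abs_le_of_sq_le_sq (by nlinarith [sq_nonneg (x' - a)]) (by positivity)
    have := C.lip a b x' y' hb0 hy'
    have h2 : K * max |a - x'| |b - y'| ≤ K * (θ * s) :=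
      mul_le_mul_of_nonneg_left (max_le i1 i2) hK0.le
    have h3 := (abs_le.1 (this.trans h2)).2
    nlinarith
  by_cases hcase : (x - a) ^ 2 + (y - b) ^ 2 ≤ (θ * s) ^ 2
  · have := hnear x y (by linarith) hcase
    have : θ ^ 2 / 6 * s ≤ 3 / 256 * s := mul_le_mul_of_nonneg_right (by nlinarith) hs.le
    linarith
  push Not at hcase
  set B := 3 * θ ^ 2 * s ^ 3 / 256 with hB
  have hB0 : 0 < B := by positivity
  set q : ℝ → ℝ → ℝ := fun x' y' => (x' - a) ^ 2 + (y' - b) ^ 2 with hq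
  set R : Set (ℝ × ℝ) := {p | (θ * s) ^ 2 ≤ q p.1 p.2 ∧ q p.1 p.2 ≤ (3 * s / 4) ^ 2} with hR
  have hqc : Continuous (fun p : ℝ × ℝ => q p.1 p.2) := by simp only [hq]; fun_prop
  have hRy : ∀ x' y', q x' y' ≤ (3 * s / 4) ^ 2 → |x' - a| ≤ 3 * s / 4 ∧ |y' - b| ≤ 3 * s / 4 := by
    intro x' y' h
    constructor
    · exact abs_le_of_sq_le_sq (by simp only [hq] at h; nlinarith [sq_nonneg (y' - b)]) (by positivity)
    · exact abs_le_of_sq_le_sq (by simp only [hq] at h; nlinarith [sq_nonneg (x' - a)]) (by positivity)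
  have hRc : IsCompact R := by
    have : R ⊆ Icc (a - 3 * s / 4) (a + 3 * s / 4) ×ˢ Icc (b - 3 * s / 4) (b + 3 * s / 4) := by
      intro p hp
      have := hRy _ _ hp.2
      have h1 := abs_le.1 this.1
      have h2 := abs_le.1 this.2
      exact ⟨⟨by linarith, by linarith⟩, ⟨by linarith, by linarith⟩⟩
    refine (isCompact_Icc.prod isCompact_Icc).of_isClosed_subset ?_ this
    exact (isClosed_le continuous_const hqc).inter (isClosed_le hqc continuous_const)
  have hRH : R ⊆ lowerH := by
    intro p hp
    have h2 := abs_le.1 (hRy _ _ hp.2).2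
    show p.2 ≤ 0
    linarith
  have hqpos : ∀ p ∈ R, 0 < q p.1 p.2 := fun p hp => lt_of_lt_of_le (by positivity) hp.1
  set w : ℝ → ℝ → ℝ := fun x' y' => -(16 * B / (9 * s ^ 2)) + B / ((x' - a) ^ 2 + (y' - b) ^ 2) with hw
  have hwc : ContinuousOn (fun p : ℝ × ℝ => w p.1 p.2) R := by
    simp only [hw]
    refine continuousOn_const.add (continuousOn_const.div hqc.continuousOn ?_)
    intro p hp; exact (hqpos p hp).ne'
  have hcomp := compare C.hd C.hD C.hμ C.tw hRc hRH hwc (by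
    intro x' y' hp
    have hq0 := hqpos _ hp
    have hy' : y' ≤ 0 := hRH hp
    simp only at hq0
    rcases hp.1.lt_or_eq with h1 | h1
    swap
    · left
      have := hnear x' y' hy' h1.symm.le
      have h1' : (x' - a) ^ 2 + (y' - b) ^ 2 = (θ * s) ^ 2 := h1.symm
      simp only [hw]
      rw [h1']
      have e : B / (θ * s) ^ 2 = 3 * s / 256 := by rw [hB]; field_simp
      rw [e]
      have : 0 < 16 * B / (9 * s ^ 2) := by positivity
      linarith
    rcases hp.2.lt_or_eq with h2 | h2
    swap
    · left
      have h2' : (x' - a) ^ 2 + (y' - b) ^ 2 = (3 * s / 4) ^ 2 := h2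
      simp only [hw]
      rw [h2']
      have e : -(16 * B / (9 * s ^ 2)) + B / (3 * s / 4) ^ 2 = 0 := by field_simp; ring
      rw [e]
      exact (C.tw.mem01 x' y' hy').1
    right; left
    simp only at h1 h2
    have hy2 : |y' - b| < 3 * s / 4 := abs_lt_of_sq_lt_sq (by simp only [hq] at h2; nlinarith [sq_nonneg (x' - a)]) (by positivity)
    have hyn : y' < 0 := by linarith [(abs_lt.1 hy2).2]
    refine ⟨?_, hyn, ?_, _, _, _, _, jet_inv hq0.ne', ?_⟩
    · apply hΩ
      simp only [hq] at h2
      obtain ⟨p, hp1, hp2⟩ : ∃ p, p < 3 * s / 4 ∧ 0 ≤ p ∧ (x' - a) ^ 2 + (y' - b) ^ 2 ≤ p ^ 2 := by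
        refine ⟨√((x' - a) ^ 2 + (y' - b) ^ 2), ?_, Real.sqrt_nonneg _, (Real.sq_sqrt (by positivity)).ge⟩
        rw [Real.sqrt_lt' (by positivity)]; exact h2
      have := sum_sq_le hp2.1 (by positivity) hp2.2 hab
      rw [show x' - a + (a - x) = x' - x by ring, show y' - b + (b - y) = y' - y by ring] at this
      refine this.trans_lt ?_
      exact pow_lt_pow_left₀ (by linarith) (by linarith [hp2.1]) two_ne_zero
    · have o1 : IsOpen {p : ℝ × ℝ | (θ * s) ^ 2 < q p.1 p.2} := isOpen_lt continuous_const hqc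
      have o2 : IsOpen {p : ℝ × ℝ | q p.1 p.2 < (3 * s / 4) ^ 2} := isOpen_lt hqc continuous_const
      filter_upwards [(o1.inter o2).mem_nhds (show (x', y') ∈ _ from ⟨h1, h2⟩)] with p hp'
      exact ⟨le_of_lt hp'.1, le_of_lt hp'.2⟩
    · rw [lap_inv hq0.ne', ← sub_pos]
      have e : d * (4 * B / ((x' - a) ^ 2 + (y' - b) ^ 2) ^ 2) -
        c * (-(B * (2 * (x' - a))) / ((x' - a) ^ 2 + (y' - b) ^ 2) ^ 2) =
        2 * B * (2 * d + c * (x' - a)) / ((x' - a) ^ 2 + (y' - b) ^ 2) ^ 2 := by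
        simp only [hq] at hq0
        field_simp; ring
      rw [e]
      have i := (abs_le.1 (hRy x' y' h2.le).1).1
      have : 0 < 2 * d + c * (x' - a) := by nlinarith
      simp only [hq] at hq0
      positivity)
  have hqs : q x y ≤ (s / 4) ^ 2 := by
    simp only [hq]; nlinarith
  have hfin := hcomp x y ⟨hcase.le, by show q x y ≤ _; nlinarith⟩
  refine le_trans ?_ hfin
  simp only [hw]
  have hq0 : 0 < q x y := lt_of_le_of_lt (by positivity) hcase
  have : B / (s / 4) ^ 2 ≤ B / ((x - a) ^ 2 + (y - b) ^ 2) :=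
    div_le_div_of_nonneg_left hB0.le hq0 hqs
  have e : B / (s / 4) ^ 2 - 16 * B / (9 * s ^ 2) = θ ^ 2 / 6 * s := by
    rw [hB]; field_simp; ring
  linarith

theorem strip_of_dist {d D μ c K : ℝ} {u : ℝ → ℝ → ℝ} {φ : ℝ → ℝ} (C : Ctx d D μ c K u φ) {x y s : ℝ}
    (hy : y ≤ 0) (hp : 0 < u x y) (hs0 : 0 < s) (hs : s ≤ Metric.infDist (x, y) (freeBdry u)) :
    ∀ y' < (0:ℝ), |y' - y| < s → x + s ≤ φ y' := by
  have hK := C.hK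
  have key : ∀ y' < (0:ℝ), |y' - y| < s → s ≤ |x - φ y'| := by
    intro y' hy' hd
    have hm : (φ y', y') ∈ freeBdry u := by rw [C.gam]; exact ⟨y', hy', rfl⟩
    have h1 := hs.trans (Metric.infDist_le_dist_of_mem hm)
    rw [Prod.dist_eq, Real.dist_eq, Real.dist_eq] at h1
    rcases le_max_iff.1 h1 with h | h
    · exact h
    · rw [abs_sub_comm] at h
      exact absurd h (not_le.2 hd)
  obtain ⟨y1, hy1, hd1, hp1⟩ : ∃ y1 < (0:ℝ), |y1 - y| < s ∧ x < φ y1 := by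
    rcases hy.lt_or_eq with h | h
    · exact ⟨y, h, by simpa using hs0, (C.pos _ _ h).1 hp⟩
    · subst h
      have hK0 : 0 < K := by linarith
      have hm : 0 < min (s / 2) (u x 0 / (2 * K)) := lt_min (by positivity) (by positivity)
      set m := min (s / 2) (u x 0 / (2 * K)) with hmdef
      have m1 : m ≤ s / 2 := min_le_left _ _
      have m2 : m ≤ u x 0 / (2 * K) := min_le_right _ _
      refine ⟨-m, by linarith, ?_, ?_⟩
      · rw [sub_zero, abs_neg, abs_of_pos hm]; linarith
      · rw [← C.pos x (-m) (by linarith)]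
        have := C.lip x 0 x (-m) le_rfl (by linarith)
        rw [sub_self, abs_zero, zero_sub, neg_neg, abs_of_pos hm, max_eq_right hm.le] at this
        have h2 := (abs_le.1 this).2
        rw [le_div_iff₀ (by positivity)] at m2
        nlinarith
  intro y' hy' hd'
  have k1 := key y' hy' hd'
  by_contra hcon
  push Not at hcon
  have hle : φ y' ≤ x := by
    by_contra h
    push Not at h
    rw [abs_sub_comm, abs_of_pos (by linarith)] at k1
    linarith
  have hsub : uIcc y' y1 ⊆ Iio 0 := by
    intro z hz
    rcases mem_uIcc.1 hz with h | h
    · exact lt_of_le_of_lt h.2 hy1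
    · exact lt_of_le_of_lt h.2 hy'
  have hiv := intermediate_value_uIcc (C.hφ.mono hsub)
  obtain ⟨z, hz, hzx⟩ := hiv (mem_uIcc.2 (Or.inl ⟨hle, hp1.le⟩))
  have hzs : |z - y| < s := by
    rw [abs_lt] at hd' hd1 ⊢
    rcases mem_uIcc.1 hz with h | h
    · constructor <;> linarith [h.1, h.2]
    · constructor <;> linarith [h.1, h.2]
  have := key z (hsub hz) hzs
  rw [hzx, sub_self, abs_zero] at this
  linarith

def IntE (u : ℝ → ℝ → ℝ) (κ r0 : ℝ) : Prop := ∀ x y s : ℝ, 0 < s → s ≤ r0 → y + s ≤ 0 →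
      (∀ x' y', (x' - x) ^ 2 + (y' - y) ^ 2 < s ^ 2 → 0 < u x' y') → κ * s ≤ u x y

theorem near_road {u : ℝ → ℝ → ℝ} {κ r0 x1 r : ℝ} (hI : IntE u κ r0)
    (hst : ∀ x' y', x' < x1 → -r < y' → y' < 0 → 0 < u x' y') (x' t : ℝ) (ht : 0 < t) (htr : t ≤ r / 2)
    (ht0 : t ≤ r0) (hx : x' + t ≤ x1) : κ * t ≤ u x' (-t) := by
  refine hI x' (-t) t ht ht0 (by linarith) ?_
  intro x'' y'' h
  have h1 : |x'' - x'| < t := abs_lt_of_sq_lt_sq (by nlinarith [sq_nonneg (y'' - -t)]) ht.le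
  have h2 : |y'' - -t| < t := abs_lt_of_sq_lt_sq (by nlinarith [sq_nonneg (x'' - x')]) ht.le
  rw [abs_lt] at h1 h2
  exact hst _ _ (by linarith) (by linarith) (by linarith)

theorem box_road {a b x r : ℝ} (h1 : a < x) (h2 : x < b) (hr : 0 < r) :
    Icc a b ×ˢ Icc (-r) 0 ∈ 𝓝[lowerH] (x, (0:ℝ)) := by
  have : Icc a b ×ˢ Icc (-r) r ∈ 𝓝 (x, (0:ℝ)) :=
    prod_mem_nhds (Icc_mem_nhds h1 h2) (Icc_mem_nhds (by linarith) hr)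
  filter_upwards [nhdsWithin_le_nhds this, self_mem_nhdsWithin] with p hp hp2
  exact ⟨hp.1, hp.2.1, hp2⟩

theorem parab {d D μ c K : ℝ} {u : ℝ → ℝ → ℝ} {φ : ℝ → ℝ} (C : Ctx d D μ c K u φ) {κ β ρ l X0 : ℝ}
    (hκ : 0 < κ) (hβ : 0 < β) (hl : 0 < l) (hl1 : l ≤ 1) (hρ : 0 < ρ)
    (h1 : μ * (β * (2 * D + 2 * c)) < κ / 4) (h2 : β * (2 + c / d) * ρ ≤ κ / 4)
    (h3 : β * l ^ 2 ≤ κ * ρ / 2) (hh : ∀ x' < X0, 0 < u x' 0)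
    (hin : ∀ x' y', x' < X0 → -ρ < y' → y' < 0 → 0 < u x' y')
    (hbd : ∀ x' y', X0 - 2 * l ≤ x' → x' ≤ X0 → -ρ ≤ y' → y' ≤ 0 → κ * (-y') ≤ u x' y') :
    ∀ τ, 0 ≤ τ → τ ≤ 2 * l → β * τ * (2 * l - τ) ≤ u (X0 - τ) 0 := by
  have hc0 := C.tw.c_pos
  have hd := C.hd
  have hμ := C.hμ
  have hD := C.hD
  set N := β * (2 + c / d) with hN
  have hN0 : 0 < N := by positivity
  have hdN : d * N = β * (2 * d + c) := by rw [hN]; field_simp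
  set w : ℝ → ℝ → ℝ := fun x y => -(κ / 4) * y + N * y ^ 2 + β * (X0 - x) * (2 * l - (X0 - x)) with hw
  have hcomp := compare hd hD hμ C.tw (R := Icc (X0 - 2 * l) X0 ×ˢ Icc (-ρ) 0) (w := w)
    (isCompact_Icc.prod isCompact_Icc) (fun p hp => hp.2.2) (by simp only [hw]; fun_prop) (by
    rintro x y ⟨⟨hx1, hx2⟩, hy1, hy2⟩
    dsimp only at hx1 hx2 hy1 hy2
    have hb := hbd x y hx1 hx2 hy1 hy2
    have hNy : N * y ^ 2 ≤ κ / 4 * (-y) := by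
      have : N * (-y) ≤ κ / 4 := by
        refine le_trans ?_ h2
        exact mul_le_mul_of_nonneg_left (by linarith) hN0.le
      nlinarith
    rcases hx2.lt_or_eq with hx2 | hx2
    swap
    · left; refine le_trans ?_ hb; simp only [hw]; rw [hx2, sub_self]; nlinarith [mul_nonneg hκ.le (neg_nonneg.2 hy2)]
    rcases hx1.lt_or_eq with hx1 | hx1
    swap
    · left; refine le_trans ?_ hb; simp only [hw]; rw [← hx1, sub_sub_cancel, sub_self]; nlinarith [mul_nonneg hκ.le (neg_nonneg.2 hy2)]
    rcases hy1.lt_or_eq with hy1 | hy1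
    swap
    · left
      refine le_trans ?_ hb
      simp only [hw]
      have : β * (X0 - x) * (2 * l - (X0 - x)) ≤ β * l ^ 2 := by
        rw [mul_assoc]
        exact mul_le_mul_of_nonneg_left (by nlinarith [sq_nonneg (l - (X0 - x))]) hβ.le
      nlinarith
    have hdx : ∀ y t : ℝ, HasDerivAt (fun t => w t y) (β * (2 * (X0 - t) - 2 * l)) t := by
      intro y t
      have h1 : HasDerivAt (fun t : ℝ => X0 - t) (-1) t := by
        simpa using (hasDerivAt_id t).const_sub X0
      have h2 : HasDerivAt (fun t => w t y) _ t :=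
        ((h1.const_mul β).mul (h1.const_sub (2 * l))).const_add (-(κ / 4) * y + N * y ^ 2)
      exact h2.congr_deriv (by ring)
    have hdxx : HasDerivAt (fun t => β * (2 * (X0 - t) - 2 * l)) (-(2 * β)) x := by
      have h1 : HasDerivAt (fun t : ℝ => X0 - t) (-1) x := by
        simpa using (hasDerivAt_id x).const_sub X0
      have h2 : HasDerivAt (fun t => β * (2 * (X0 - t) - 2 * l)) _ x :=
        ((h1.const_mul 2).sub_const (2 * l)).const_mul β
      exact h2.congr_deriv (by ring)
    have hdy : ∀ t : ℝ, HasDerivAt (fun t => w x t) (-(κ / 4) + 2 * N * t) t := by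
      intro t
      have h2 : HasDerivAt (fun t => w x t) _ t :=
        (((hasDerivAt_id t).const_mul (-(κ / 4))).add (((hasDerivAt_id t).pow 2).const_mul N)).add_const
          (β * (X0 - x) * (2 * l - (X0 - x)))
      exact h2.congr_deriv (by simp; ring)
    have hdyy : HasDerivAt (fun t => -(κ / 4) + 2 * N * t) (2 * N) y := by
      simpa using ((hasDerivAt_id y).const_mul (2 * N)).const_add (-(κ / 4))
    have hw1 : c * (β * (2 * (X0 - x) - 2 * l)) ≤ c * (β * 2) := by
      apply mul_le_mul_of_nonneg_left _ hc0.le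
      apply mul_le_mul_of_nonneg_left _ hβ.le
      linarith
    rcases hy2.lt_or_eq with hy2 | hy2
    · right; left
      refine ⟨hin _ _ hx2 hy1 hy2, hy2, prod_mem_nhds (Icc_mem_nhds hx1 hx2) (Icc_mem_nhds hy1 hy2),
        fun x _ => β * (2 * (X0 - x) - 2 * l), fun _ y => -(κ / 4) + 2 * N * y, -(2 * β), 2 * N,
        ⟨Eventually.of_forall (hdx y), hdxx, Eventually.of_forall hdy, hdyy⟩, ?_⟩
      dsimp only
      nlinarith [mul_pos hd hβ]
    · right; right
      refine ⟨hh x hx2, hy2, box_road hx1 hx2 hρ, fun x => β * (2 * (X0 - x) - 2 * l), -(2 * β),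
        -(κ / 4) + 2 * N * 0, Eventually.of_forall (hdx 0), hdxx, hdy 0, ?_⟩
      have h4 : β * (2 * D + 2 * c) < 1 / μ * (κ / 4) := by
        rw [one_div, inv_mul_eq_div, lt_div_iff₀ hμ]; linarith
      dsimp only
      linarith)
  intro τ h0 hτ
  have := hcomp (X0 - τ) 0 ⟨⟨by dsimp only; linarith, by dsimp only; linarith⟩, ⟨by dsimp only; linarith, le_rfl⟩⟩
  simp only [hw] at this
  refine le_trans (le_of_eq ?_) this
  ring

theorem parab2 {d D μ c K : ℝ} {u : ℝ → ℝ → ℝ} {φ : ℝ → ℝ} (C : Ctx d D μ c K u φ) {κ r0 : ℝ}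
    (hκ : 0 < κ) (hr0 : 0 < r0) (hI : IntE u κ r0) :
    ∃ β > 0, ∃ c4 > 0, ∃ r1 > 0, ∀ r X0, 0 < r → r ≤ r1 → (∀ x' < X0, 0 < u x' 0) →
      (∀ x' y', x' < X0 + r → -r < y' → y' < 0 → 0 < u x' y') →
      ∀ τ, 0 ≤ τ → τ ≤ 2 * (c4 * √r) → β * τ * (2 * (c4 * √r) - τ) ≤ u (X0 - τ) 0 := by
  have hc0 := C.tw.c_pos
  have hd := C.hd
  have hμ := C.hμ
  have hD := C.hD
  set β := κ / (16 * μ * (D + c)) with hβ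
  have hβ0 : 0 < β := by positivity
  have hβ1 : μ * (β * (2 * D + 2 * c)) = κ / 8 := by rw [hβ]; field_simp; ring
  have hc4 : 0 < √(κ / (4 * β)) := Real.sqrt_pos.2 (by positivity)
  set c4 := √(κ / (4 * β)) with hc4d
  have hc42 : c4 ^ 2 = κ / (4 * β) := Real.sq_sqrt (by positivity)
  have hN0 : 0 < β * (2 + c / d) := by positivity
  refine ⟨β, hβ0, c4, hc4, min (κ / (2 * (β * (2 + c / d)))) (min (4 * β / κ) (2 * r0)), ?_, ?_⟩
  · exact lt_min (by positivity) (lt_min (by positivity) (by positivity))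
  intro r X0 hr hr1 hh hst
  have k1 := hr1.trans (min_le_left _ _)
  have k2 := hr1.trans ((min_le_right _ _).trans (min_le_left _ _))
  have k3 := hr1.trans ((min_le_right _ _).trans (min_le_right _ _))
  have hl : 0 < c4 * √r := mul_pos hc4 (Real.sqrt_pos.2 hr)
  have hl2 : (c4 * √r) ^ 2 = κ / (4 * β) * r := by rw [mul_pow, hc42, Real.sq_sqrt hr.le]
  refine parab C (ρ := r / 2) hκ hβ0 hl ?_ (by positivity) (by rw [hβ1]; linarith) ?_ ?_ hh ?_ ?_
  · apply le_of_sq_le_sq _ zero_le_one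
    rw [hl2, one_pow]
    calc κ / (4 * β) * r ≤ κ / (4 * β) * (4 * β / κ) := mul_le_mul_of_nonneg_left k2 (by positivity)
      _ = 1 := by field_simp
  · rw [le_div_iff₀ (by positivity)] at k1
    linarith
  · rw [hl2]
    apply le_of_eq; field_simp; ring
  · intro x' y' h1 h2 h3
    exact hst x' y' (by linarith) (by linarith) h3
  · intro x' y' _ h2 h3 h4
    rcases h4.lt_or_eq with h | h
    · have := near_road hI hst x' (-y') (by linarith) (by linarith) (by linarith) (by linarith)
      rwa [neg_neg] at this
    · rw [h, neg_zero, mul_zero]; exact (C.tw.mem01 _ _ le_rfl).1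

theorem ylog_cont (a : ℝ) : Continuous (fun p : ℝ × ℝ => p.2 * Real.log ((p.1 - a) ^ 2 + p.2 ^ 2)) := by
  rw [continuous_iff_continuousAt]
  intro p
  have hqc : Continuous (fun p : ℝ × ℝ => (p.1 - a) ^ 2 + p.2 ^ 2) := by fun_prop
  by_cases h : (p.1 - a) ^ 2 + p.2 ^ 2 = 0
  · have hp2 : p.2 = 0 := by nlinarith [sq_nonneg (p.1 - a), sq_nonneg p.2]
    have hg : Continuous (fun p : ℝ × ℝ => 2 * |√((p.1 - a) ^ 2 + p.2 ^ 2) * Real.log √((p.1 - a) ^ 2 + p.2 ^ 2)|) :=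
      (continuous_const.mul ((Real.continuous_mul_log.comp (Real.continuous_sqrt.comp hqc)).abs))
    have hg0 := hg.tendsto p
    simp only [h, Real.sqrt_zero, zero_mul, abs_zero, mul_zero] at hg0
    have : Tendsto (fun p : ℝ × ℝ => p.2 * Real.log ((p.1 - a) ^ 2 + p.2 ^ 2)) (𝓝 p) (𝓝 0) := by
      refine squeeze_zero_norm ?_ hg0
      intro z
      rw [Real.norm_eq_abs, Real.log_sqrt (by positivity), abs_mul, abs_mul, abs_div, abs_two,
        abs_of_nonneg (Real.sqrt_nonneg _)]
      have : |z.2| ≤ √((z.1 - a) ^ 2 + z.2 ^ 2) := Real.abs_le_sqrt (by nlinarith [sq_nonneg (z.1 - a)])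
      have h2 := mul_le_mul_of_nonneg_right this (abs_nonneg (Real.log ((z.1 - a) ^ 2 + z.2 ^ 2)))
      linarith
    unfold ContinuousAt
    simp only [hp2, zero_mul]
    exact this
  · exact continuous_snd.continuousAt.mul (hqc.continuousAt.log h)

theorem sq_add_deriv (a k t : ℝ) : HasDerivAt (fun t : ℝ => (t - a) ^ 2 + k) (2 * (t - a)) t := by
  have := (((hasDerivAt_id t).sub_const a).pow 2).add_const k
  simpa using this

theorem sqrt_d1 {a k t : ℝ} (h : 0 < (t - a) ^ 2 + k) :
    HasDerivAt (fun t => √((t - a) ^ 2 + k)) ((t - a) / √((t - a) ^ 2 + k)) t := by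
  refine ((sq_add_deriv a k t).sqrt h.ne').congr_deriv ?_
  have := Real.sqrt_pos.2 h
  field_simp

theorem sqrt_d2 {a k t : ℝ} (h : 0 < (t - a) ^ 2 + k) :
    HasDerivAt (fun t => (t - a) / √((t - a) ^ 2 + k)) (k / (((t - a) ^ 2 + k) * √((t - a) ^ 2 + k))) t := by
  have h1 : HasDerivAt (fun t : ℝ => t - a) 1 t := (hasDerivAt_id t).sub_const a
  have hs := Real.sqrt_pos.2 h
  have h2 : HasDerivAt (fun t => (t - a) / √((t - a) ^ 2 + k)) _ t := h1.div (sqrt_d1 h) hs.ne'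
  refine h2.congr_deriv ?_
  have e := Real.sq_sqrt h.le
  set s := √((t - a) ^ 2 + k)
  rw [← e]
  field_simp
  linarith

theorem log_d1 {a k t : ℝ} (h : 0 < (t - a) ^ 2 + k) :
    HasDerivAt (fun t => Real.log ((t - a) ^ 2 + k)) (2 * (t - a) / ((t - a) ^ 2 + k)) t :=
  (sq_add_deriv a k t).log h.ne'

theorem log_d2 {a k t : ℝ} (h : 0 < (t - a) ^ 2 + k) :
    HasDerivAt (fun t => 2 * (t - a) / ((t - a) ^ 2 + k))
      (2 / ((t - a) ^ 2 + k) - 4 * (t - a) ^ 2 / ((t - a) ^ 2 + k) ^ 2) t := by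
  have h1 : HasDerivAt (fun t : ℝ => 2 * (t - a)) (2 * 1) t := ((hasDerivAt_id t).sub_const a).const_mul 2
  have h2 : HasDerivAt (fun t => 2 * (t - a) / ((t - a) ^ 2 + k)) _ t := h1.div (sq_add_deriv a k t) h.ne'
  refine h2.congr_deriv ?_
  field_simp
  ring

theorem jet_log {A B m x y : ℝ} (h : 0 < (x - A) ^ 2 + y ^ 2) :
    JetAt (fun x y => B * (5 * (√((x - A) ^ 2 + y ^ 2) - (x - A)) + y * Real.log ((x - A) ^ 2 + y ^ 2)) + m * y)
      (fun x y => B * (5 * ((x - A) / √((x - A) ^ 2 + y ^ 2) - 1) + y * (2 * (x - A) / ((x - A) ^ 2 + y ^ 2))))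
      (fun x y => B * (5 * (y / √((x - A) ^ 2 + y ^ 2)) + (Real.log ((x - A) ^ 2 + y ^ 2) +
        y * (2 * y / ((x - A) ^ 2 + y ^ 2)))) + m) x y
      (B * (5 * (y ^ 2 / (((x - A) ^ 2 + y ^ 2) * √((x - A) ^ 2 + y ^ 2))) +
        y * (2 / ((x - A) ^ 2 + y ^ 2) - 4 * (x - A) ^ 2 / ((x - A) ^ 2 + y ^ 2) ^ 2)))
      (B * (5 * ((x - A) ^ 2 / (((x - A) ^ 2 + y ^ 2) * √((x - A) ^ 2 + y ^ 2))) +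
        (2 * y / ((x - A) ^ 2 + y ^ 2) + (2 * y / ((x - A) ^ 2 + y ^ 2) +
        y * (2 / ((x - A) ^ 2 + y ^ 2) - 4 * y ^ 2 / ((x - A) ^ 2 + y ^ 2) ^ 2))))) where
  dx := by
    have hc : ContinuousAt (fun t : ℝ => (t - A) ^ 2 + y ^ 2) x := by fun_prop
    filter_upwards [hc.eventually (lt_mem_nhds h)] with t ht
    have h1 : HasDerivAt (fun t : ℝ => t - A) 1 t := (hasDerivAt_id t).sub_const A
    exact (((((sqrt_d1 ht).sub h1).const_mul 5).add ((log_d1 ht).const_mul y)).const_mul B).add_const (m * y)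
  dxx := by
    exact (((((sqrt_d2 h).sub_const 1).const_mul 5).add ((log_d2 h).const_mul y)).const_mul B)
  dy := by
    have hc : ContinuousAt (fun t : ℝ => (x - A) ^ 2 + t ^ 2) y := by fun_prop
    filter_upwards [hc.eventually (lt_mem_nhds h)] with t ht
    have ht' : 0 < (t - 0) ^ 2 + (x - A) ^ 2 := by rw [sub_zero, add_comm]; exact ht
    have d1 := sqrt_d1 ht'
    have d2 := log_d1 ht'
    simp only [sub_zero, add_comm _ ((x - A) ^ 2)] at d1 d2
    have d3 : HasDerivAt (fun t => B * (5 * (√((x - A) ^ 2 + t ^ 2) - (x - A)) +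
      t * Real.log ((x - A) ^ 2 + t ^ 2)) + m * t) _ t :=
      ((((d1.sub_const (x - A)).const_mul 5).add ((hasDerivAt_id t).mul d2)).const_mul B).add
      ((hasDerivAt_id t).const_mul m)
    refine d3.congr_deriv ?_
    simp only [id]
    ring
  dyy := by
    have ht' : 0 < (y - 0) ^ 2 + (x - A) ^ 2 := by rw [sub_zero, add_comm]; exact h
    have d1 := sqrt_d2 ht'
    have d2 := log_d1 ht'
    have d4 := log_d2 ht'
    simp only [sub_zero, add_comm _ ((x - A) ^ 2)] at d1 d2 d4
    have d3 : HasDerivAt (fun t => B * (5 * (t / √((x - A) ^ 2 + t ^ 2)) + (Real.log ((x - A) ^ 2 + t ^ 2) +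
        t * (2 * t / ((x - A) ^ 2 + t ^ 2)))) + m) _ y :=
      (((d1.const_mul 5).add (d2.add ((hasDerivAt_id y).mul d4))).const_mul B).add_const m
    refine d3.congr_deriv ?_
    simp only [id]
    ring

theorem lap_log {X y s B : ℝ} (hs : 0 < s) (e : X ^ 2 + y ^ 2 = s ^ 2) :
    (B * (5 * (y ^ 2 / ((X ^ 2 + y ^ 2) * s)) +
        y * (2 / (X ^ 2 + y ^ 2) - 4 * X ^ 2 / (X ^ 2 + y ^ 2) ^ 2))) +
      (B * (5 * (X ^ 2 / ((X ^ 2 + y ^ 2) * s)) +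
        (2 * y / (X ^ 2 + y ^ 2) + (2 * y / (X ^ 2 + y ^ 2) +
        y * (2 / (X ^ 2 + y ^ 2) - 4 * y ^ 2 / (X ^ 2 + y ^ 2) ^ 2))))) = B * ((5 * s + 4 * y) / s ^ 2) := by
  have hX : X ^ 2 = s ^ 2 - y ^ 2 := by linarith
  rw [e, hX]
  field_simp
  ring

set_option maxHeartbeats 1000000 in
theorem no_touch {d D μ c K : ℝ} {u : ℝ → ℝ → ℝ} {φ : ℝ → ℝ} (C : Ctx d D μ c K u φ) {κ r0 : ℝ}
    (hκ : 0 < κ) (hr0 : 0 < r0) (hI : IntE u κ r0) {Xs η r : ℝ} (hη : 0 < η) (hr : 0 < r)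
    (hh : ∀ x' < Xs, 0 < u x' 0) (h0 : u Xs 0 = 0)
    (hst : ∀ x' y', x' < Xs + η → -r < y' → y' < 0 → 0 < u x' y') : False := by
  have hc0 := C.tw.c_pos
  have hd := C.hd
  have hK := C.hK
  have hK0 : 0 < K := by linarith
  obtain ⟨β, hβ, c4, hc4, r1, hr1, hpar⟩ := parab2 C hκ hr0 hI
  obtain ⟨r', hr', ha, hb, hc⟩ : ∃ r' > 0, r' ≤ r ∧ r' ≤ η ∧ r' ≤ r1 :=
    ⟨min r (min η r1), lt_min hr (lt_min hη hr1), min_le_left _ _,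
      (min_le_right _ _).trans (min_le_left _ _), (min_le_right _ _).trans (min_le_right _ _)⟩
  have hst' : ∀ x' y', x' < Xs + r' → -r' < y' → y' < 0 → 0 < u x' y' := fun x' y' h1 h2 h3 =>
    hst x' y' (by linarith) (by linarith) h3
  have hp := hpar r' Xs hr' hc hh hst'
  have hl : 0 < c4 * √r' := mul_pos hc4 (Real.sqrt_pos.2 hr')
  set l := c4 * √r' with hldef
  obtain ⟨ρ, hρ, p1, p2, p3, p4⟩ : ∃ ρ > 0, ρ ≤ l ∧ ρ ≤ r' / 4 ∧ ρ ≤ r0 ∧ ρ ≤ d / (4 * c) :=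
    ⟨min (min l (r' / 4)) (min r0 (d / (4 * c))), lt_min (lt_min hl (by positivity)) (lt_min hr0 (by positivity)),
      (min_le_left _ _).trans (min_le_left _ _), (min_le_left _ _).trans (min_le_right _ _),
      (min_le_right _ _).trans (min_le_left _ _), (min_le_right _ _).trans (min_le_right _ _)⟩
  have p4' : 4 * (c * ρ) ≤ d := by
    rw [le_div_iff₀ (by positivity)] at p4; linarith
  have hc0' : 0 < β * l := by positivity
  set c1 := β * l * κ / (κ + K) with hc1
  have hc1p : 0 < c1 := by positivity
  -- lower bound
  have hlow : ∀ x y, Xs - ρ ≤ x → x ≤ Xs + ρ → -ρ ≤ y → y ≤ 0 → c1 * (Xs - x) ≤ u x y := by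
    intro x y h1 h2 h3 h4
    have hu0 := (C.tw.mem01 x y h4).1
    rcases le_or_gt Xs x with h | h
    · have : c1 * (Xs - x) ≤ 0 := mul_nonpos_of_nonneg_of_nonpos hc1p.le (by linarith)
      linarith
    have k1 : κ * (-y) ≤ u x y := by
      rcases h4.lt_or_eq with h5 | h5
      · have := near_road hI hst' x (-y) (by linarith) (by linarith) (by linarith) (by linarith)
        rwa [neg_neg] at this
      · have : κ * (-y) = 0 := by rw [h5]; ring
        linarith
    have k2 : β * l * (Xs - x) ≤ u x 0 := by
      have := hp (Xs - x) (by linarith) (by linarith)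
      rw [sub_sub_cancel] at this
      refine le_trans ?_ this
      have : β * (Xs - x) * l ≤ β * (Xs - x) * (2 * l - (Xs - x)) :=
        mul_le_mul_of_nonneg_left (by linarith) (mul_nonneg hβ.le (by linarith))
      linarith
    have k3 : u x 0 ≤ u x y + K * (-y) := by
      have := C.lip x 0 x y le_rfl h4
      rw [sub_self, abs_zero, zero_sub, abs_of_nonneg (by linarith : 0 ≤ -y), max_eq_right (by linarith)] at this
      linarith [(abs_le.1 this).2]
    rw [hc1, div_mul_eq_mul_div, div_le_iff₀ (by positivity)]
    nlinarith [mul_le_mul_of_nonneg_left k2 hκ.le, mul_le_mul_of_nonneg_left k3 hκ.le, mul_le_mul_of_nonneg_left k1 hK0.le]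
  set a := c1 / 10 with hadef
  have ha0 : 0 < a := by positivity
  have hc10 : c1 = 10 * a := by rw [hadef]; ring
  set m := 5 * a - a * Real.log (ρ ^ 2) with hm
  set w : ℝ → ℝ → ℝ := fun x y => a * (5 * (√((x - Xs) ^ 2 + y ^ 2) - (x - Xs)) +
    y * Real.log ((x - Xs) ^ 2 + y ^ 2)) + m * y with hw
  have hwc : Continuous (fun p : ℝ × ℝ => w p.1 p.2) := by
    have h1 := ylog_cont Xs
    have h2 : Continuous (fun p : ℝ × ℝ => √((p.1 - Xs) ^ 2 + p.2 ^ 2) - (p.1 - Xs)) := by fun_prop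
    exact (continuous_const.mul ((continuous_const.mul h2).add h1)).add (continuous_const.mul continuous_snd)
  -- the positive part bound
  have hlow' : ∀ x y, Xs - ρ ≤ x → x ≤ Xs + ρ → -ρ ≤ y → y ≤ 0 →
      5 * a * (|x - Xs| - (x - Xs)) ≤ u x y := by
    intro x y h1 h2 h3 h4
    rcases le_or_gt Xs x with h | h
    · rw [abs_of_nonneg (by linarith), sub_self, mul_zero]
      exact (C.tw.mem01 x y h4).1
    · have := hlow x y h1 h2 h3 h4
      rw [abs_of_neg (by linarith)]
      rw [hc10] at this
      linarith
  have hside : ∀ x y, Xs - ρ ≤ x → x ≤ Xs + ρ → -ρ ≤ y → y ≤ 0 → ρ ^ 2 ≤ (x - Xs) ^ 2 + y ^ 2 →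
      w x y ≤ u x y := by
    intro x y h1 h2 h3 h4 h5
    refine le_trans ?_ (hlow' x y h1 h2 h3 h4)
    have i1 : √((x - Xs) ^ 2 + y ^ 2) ≤ |x - Xs| - y := by
      rw [Real.sqrt_le_left (by linarith [abs_nonneg (x - Xs)])]
      have := sq_abs (x - Xs)
      nlinarith [mul_nonneg (abs_nonneg (x - Xs)) (neg_nonneg.2 h4)]
    have i2 : y * Real.log ((x - Xs) ^ 2 + y ^ 2) ≤ y * Real.log (ρ ^ 2) :=
      mul_le_mul_of_nonpos_left (Real.log_le_log (by positivity) h5) h4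
    have i3 : a * (5 * (√((x - Xs) ^ 2 + y ^ 2) - (x - Xs)) + y * Real.log ((x - Xs) ^ 2 + y ^ 2)) ≤
       a * (5 * (|x - Xs| - y - (x - Xs)) + y * Real.log (ρ ^ 2)) :=
      mul_le_mul_of_nonneg_left (by linarith) ha0.le
    simp only [hw]
    rw [hm]
    nlinarith
  have hcomp := compare hd C.hD C.hμ C.tw (R := Icc (Xs - ρ) (Xs + ρ) ×ˢ Icc (-ρ) 0) (w := w)
    (isCompact_Icc.prod isCompact_Icc) (fun p hp => hp.2.2) hwc.continuousOn (by
    rintro x y ⟨⟨hx1, hx2⟩, hy1, hy2⟩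
    dsimp only at hx1 hx2 hy1 hy2
    rcases hy2.lt_or_eq with hy2' | hy2'
    swap
    · left
      refine le_trans (le_of_eq ?_) (hlow' x y hx1 hx2 hy1 hy2)
      simp only [hw]
      rw [hy2']
      rw [zero_pow two_ne_zero, add_zero, Real.sqrt_sq_eq_abs]
      ring
    by_cases hq : ρ ^ 2 ≤ (x - Xs) ^ 2 + y ^ 2
    · left; exact hside x y hx1 hx2 hy1 hy2 hq
    push Not at hq
    have hX : |x - Xs| < ρ := abs_lt_of_sq_lt_sq (by nlinarith [sq_nonneg y]) hρ.le
    have hY : |y| < ρ := abs_lt_of_sq_lt_sq (by nlinarith [sq_nonneg (x - Xs)]) hρ.le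
    rw [abs_lt] at hX hY
    right; left
    have hq0 : 0 < (x - Xs) ^ 2 + y ^ 2 := by nlinarith [sq_nonneg (x - Xs)]
    refine ⟨hst' _ _ (by linarith) (by linarith) hy2', hy2', prod_mem_nhds (Icc_mem_nhds (by linarith) (by linarith))
      (Icc_mem_nhds (by linarith) hy2'), _, _, _, _, jet_log hq0, ?_⟩
    have hs := Real.sqrt_pos.2 hq0
    have e := (Real.sq_sqrt hq0.le).symm
    rw [lap_log hs e]
    set s := √((x - Xs) ^ 2 + y ^ 2)
    have hsρ : s < ρ := lt_of_pow_lt_pow_left₀ 2 hρ.le (by linarith)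
    have hXs : (x - Xs) ≤ s := le_of_sq_le_sq (by nlinarith [sq_nonneg y]) hs.le
    have hys : -y ≤ s := le_of_sq_le_sq (by nlinarith [sq_nonneg (x - Xs)]) hs.le
    have j1 : (x - Xs) / s ≤ 1 := (div_le_one hs).2 hXs
    have j2 : y * (2 * (x - Xs) / ((x - Xs) ^ 2 + y ^ 2)) ≤ 1 := by
      rw [← mul_div_assoc, div_le_one hq0]
      nlinarith [sq_nonneg (x - Xs - y)]
    have j3 : 1 / s ≤ (5 * s + 4 * y) / s ^ 2 := by
      rw [div_le_div_iff₀ hs (by positivity)]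
      nlinarith
    have j4 : c < d * (1 / s) := by
      rw [mul_one_div, lt_div_iff₀ hs]
      nlinarith
    calc c * (a * (5 * ((x - Xs) / s - 1) + y * (2 * (x - Xs) / ((x - Xs) ^ 2 + y ^ 2)))) ≤ c * (a * 1) := by
          apply mul_le_mul_of_nonneg_left _ hc0.le
          apply mul_le_mul_of_nonneg_left _ ha0.le
          linarith
      _ = a * c := by ring
      _ < a * (d * (1 / s)) := mul_lt_mul_of_pos_left j4 ha0
      _ = d * (a * (1 / s)) := by ring
      _ ≤ _ := by
          apply mul_le_mul_of_nonneg_left _ hd.le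
          exact mul_le_mul_of_nonneg_left j3 ha0.le)
  obtain ⟨t, ht0, ht1, ht2⟩ : ∃ t > 0, t ≤ ρ ∧ t ≤ Real.exp ((5 * a - m - K) / (2 * a) - 1) :=
    ⟨min ρ _, lt_min hρ (Real.exp_pos _), min_le_left _ _, min_le_right _ _⟩
  have f1 := hcomp Xs (-t) ⟨⟨by dsimp only; linarith, by dsimp only; linarith⟩, by dsimp only; linarith, by dsimp only; linarith⟩
  have f2 : u Xs (-t) ≤ K * t := by
    have := C.lip Xs (-t) Xs 0 (by linarith) le_rfl
    rw [sub_self, abs_zero, sub_zero, abs_neg, abs_of_pos ht0, max_eq_right ht0.le, h0, sub_zero] at this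
    linarith [(abs_le.1 this).2]
  simp only [hw] at f1
  rw [sub_self, zero_pow two_ne_zero, zero_add, neg_sq, Real.sqrt_sq ht0.le, Real.log_pow, sub_zero] at f1
  push_cast at f1
  have f3 : Real.log t ≤ (5 * a - m - K) / (2 * a) - 1 := by
    have := Real.log_le_log ht0 ht2
    rwa [Real.log_exp] at this
  have f4 : 2 * a * Real.log t ≤ (5 * a - m - K) - 2 * a := by
    calc 2 * a * Real.log t ≤ 2 * a * ((5 * a - m - K) / (2 * a) - 1) := mul_le_mul_of_nonneg_left f3 (by positivity)
      _ = _ := by field_simp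
  nlinarith [mul_le_mul_of_nonneg_left f4 ht0.le, mul_pos ha0 ht0]

theorem mv_le {f f' : ℝ → ℝ} {a b M : ℝ} (hab : a ≤ b) (h : ∀ z ∈ Icc a b, HasDerivAt f (f' z) z)
    (hM : ∀ z ∈ Icc a b, f' z ≤ M) : f b - f a ≤ M * (b - a) := by
  refine (convex_Icc a b).image_sub_le_mul_sub_of_deriv_le
    (fun z hz => (h z hz).continuousAt.continuousWithinAt)
    (fun z hz => (h z (interior_subset hz)).differentiableAt.differentiableWithinAt)
    (fun z hz => ?_) a (left_mem_Icc.2 hab) b (right_mem_Icc.2 hab) hab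
  rw [(h z (interior_subset hz)).deriv]
  exact hM z (interior_subset hz)

theorem taylor_fwd {f f' f'' : ℝ → ℝ} {a b M : ℝ} (hab : a ≤ b) (h : ∀ z ∈ Icc a b, HasDerivAt f (f' z) z)
    (h' : ∀ z ∈ Icc a b, HasDerivAt f' (f'' z) z)
    (hM : ∀ z ∈ Icc a b, f'' z ≤ M) : f b ≤ f a + f' a * (b - a) + M * (b - a) ^ 2 / 2 := by
  have := mv_le (f := fun z => f z - f' a * (z - a) - M / 2 * (z - a) ^ 2)
    (f' := fun z => f' z - f' a - M * (z - a)) (M := 0) hab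
    (fun z hz => by
      have h1 : HasDerivAt (fun z : ℝ => z - a) 1 z := (hasDerivAt_id z).sub_const a
      have h2 : HasDerivAt (fun z => f z - f' a * (z - a) - M / 2 * (z - a) ^ 2) _ z :=
        ((h z hz).sub (h1.const_mul (f' a))).sub ((h1.pow 2).const_mul (M / 2))
      exact h2.congr_deriv (by norm_num; ring))
    (fun z hz => by
      have := mv_le hz.1 (fun t ht => h' t ⟨ht.1, ht.2.trans hz.2⟩) (fun t ht => hM t ⟨ht.1, ht.2.trans hz.2⟩)
      linarith)
  nlinarith

theorem taylor_bwd {f f' f'' : ℝ → ℝ} {a b M : ℝ} (hab : a ≤ b) (h : ∀ z ∈ Icc a b, HasDerivAt f (f' z) z)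
    (h' : ∀ z ∈ Icc a b, HasDerivAt f' (f'' z) z)
    (hM : ∀ z ∈ Icc a b, f'' z ≤ M) : f a ≤ f b - f' b * (b - a) + M * (b - a) ^ 2 / 2 := by
  have := mv_le (f := fun z => f' b * (z - b) + M / 2 * (z - b) ^ 2 - f z)
    (f' := fun z => f' b + M * (z - b) - f' z) (M := M * (b - a) - M * (b - a)) hab
    (fun z hz => by
      have h1 : HasDerivAt (fun z : ℝ => z - b) 1 z := (hasDerivAt_id z).sub_const b
      have h2 : HasDerivAt (fun z => f' b * (z - b) + M / 2 * (z - b) ^ 2 - f z) _ z :=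
        ((h1.const_mul (f' b)).add ((h1.pow 2).const_mul (M / 2))).sub (h z hz)
      exact h2.congr_deriv (by norm_num; ring))
    (fun z hz => by
      have := mv_le hz.2 (fun t ht => h' t ⟨hz.1.trans ht.1, ht.2⟩) (fun t ht => hM t ⟨hz.1.trans ht.1, ht.2⟩)
      linarith)
  nlinarith

theorem road_pos_of_strip {d D μ c K : ℝ} {u : ℝ → ℝ → ℝ} {φ : ℝ → ℝ} (C : Ctx d D μ c K u φ) {κ r0 : ℝ}
    (hκ : 0 < κ) (hr0 : 0 < r0) (hI : IntE u κ r0) {x1 r : ℝ} (hr : 0 < r)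
    (hst : ∀ x' y', x' < x1 → -r < y' → y' < 0 → 0 < u x' y') : ∀ x' < x1, 0 < u x' 0 := by
  intro x' hx'
  by_contra hcon
  have hc : Continuous (fun t => u t 0) := by
    rw [← continuousOn_univ]
    exact C.tw.cont.comp (f := fun t : ℝ => (t, (0:ℝ))) (by fun_prop) (fun t _ => le_refl (0:ℝ))
  obtain ⟨M, hM⟩ := C.tw.lim_left (1 / 2) (by norm_num)
  set Z : Set ℝ := {t | u t 0 ≤ 0} with hZ
  have hZc : IsClosed Z := isClosed_le hc continuous_const
  have hZb : BddBelow Z := by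
    refine ⟨M, fun t ht => ?_⟩
    by_contra h
    push Not at h
    have h1 := (abs_lt.1 (hM t h.le 0 le_rfl)).1
    have h2 : u t 0 ≤ 0 := ht
    linarith
  have hZn : Z.Nonempty := ⟨x', not_lt.1 hcon⟩
  have hmem := hZc.csInf_mem hZn hZb
  have hle : sInf Z ≤ x' := csInf_le hZb (not_lt.1 hcon)
  refine no_touch C hκ hr0 hI (Xs := sInf Z) (η := x1 - sInf Z) (by linarith) hr ?_ ?_ ?_
  · intro t ht
    by_contra h
    exact absurd (csInf_le hZb (show t ∈ Z from not_lt.1 h)) (not_le.2 ht)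
  · exact le_antisymm hmem (C.tw.mem01 _ _ le_rfl).1
  · intro a b h1 h2 h3
    exact hst a b (by linarith) h2 h3

theorem pdy_le {d D μ c K : ℝ} {u : ℝ → ℝ → ℝ} {φ : ℝ → ℝ} (C : Ctx d D μ c K u φ) {x : ℝ}
    (hx : 0 < u x 0) : pdy u x 0 ≤ K := by
  have h1 := (C.tw.road_diffy x hx).hasDerivAt
  have h2 : HasDerivAt (fun t => u x t - K * t) _ 0 := h1.sub ((hasDerivAt_id (0:ℝ)).const_mul K)
  have := left_deriv_nonpos h2 (by
    filter_upwards [self_mem_nhdsWithin] with t ht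
    have ht' : t < 0 := ht
    have := C.lip x 0 x t le_rfl ht'.le
    rw [sub_self, abs_zero, zero_sub, abs_of_nonneg (by linarith : 0 ≤ -t), max_eq_right (by linarith)] at this
    linarith [(abs_le.1 this).2])
  unfold pdy
  linarith

theorem road_est {d D μ c K : ℝ} {u : ℝ → ℝ → ℝ} {φ : ℝ → ℝ} (C : Ctx d D μ c K u φ) {κ r0 : ℝ}
    (hκ : 0 < κ) (hr0 : 0 < r0) (hI : IntE u κ r0) :
    ∃ ε > 0, ∃ r1 > 0, ∀ x r, 0 < r → r ≤ r1 →
      (∀ x' y', x' < x + r → -r < y' → y' < 0 → 0 < u x' y') → ε * r ≤ u x 0 := by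
  have hc0 := C.tw.c_pos
  have hK0 : 0 < K := by linarith [C.hK]
  have hD := C.hD
  have hμ := C.hμ
  set C0 := K / (D * μ) with hC0
  have hC0p : 0 < C0 := by positivity
  have hdx : ∀ x, 0 < u x 0 → HasDerivAt (fun t => u t 0) (pdx u x 0) x := fun x hx =>
    (C.tw.road_diffx x hx).hasDerivAt
  have hdxx : ∀ x, 0 < u x 0 → HasDerivAt (fun t => pdx u t 0) (pdxx u x 0) x := fun x hx =>
    (C.tw.road_diffxx x hx).hasDerivAt
  have hxx : ∀ x, 0 < u x 0 → pdxx u x 0 ≤ C0 := by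
    intro x hx
    have h1 := C.tw.road x hx
    have h2 := C.mono x 0 le_rfl hx
    have h3 : (1 / μ) * pdy u x 0 ≤ (1 / μ) * K := mul_le_mul_of_nonneg_left (pdy_le C hx) (by positivity)
    rw [hC0, le_div_iff₀ (by positivity)]
    have h4 : D * pdxx u x 0 ≤ (1 / μ) * K := by nlinarith
    have h5 : D * pdxx u x 0 * μ ≤ (1 / μ) * K * μ := mul_le_mul_of_nonneg_right h4 hμ.le
    have h6 : (1 / μ) * K * μ = K := by field_simp
    linarith
  obtain ⟨β, hβ, c4, hc4, r1, hr1, hpar⟩ := parab2 C hκ hr0 hI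
  by_cases hii : ∀ x, 0 < u x 0 → ∀ t, 0 ≤ t → C0 * t < -pdx u x 0 → 0 < u (x + t) 0
  · obtain ⟨θ, hθ, hθ1, hθ2⟩ : ∃ θ > 0, θ ≤ 1 ∧ C0 * θ ≤ β / 2 := by
      refine ⟨min 1 (β / (2 * C0)), lt_min one_pos (by positivity), min_le_left _ _, ?_⟩
      calc C0 * min 1 (β / (2 * C0)) ≤ C0 * (β / (2 * C0)) :=
            mul_le_mul_of_nonneg_left (min_le_right _ _) hC0p.le
        _ = β / 2 := by field_simp
    obtain ⟨ε, hε, hε1, hε2⟩ : ∃ ε > 0, ε ≤ c4 ^ 2 * θ * β / 4 ∧ ε ≤ β ^ 2 * c4 ^ 2 / (16 * C0) :=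
      ⟨min _ _, lt_min (by positivity) (by positivity), min_le_left _ _, min_le_right _ _⟩
    refine ⟨ε, hε, r1, hr1, ?_⟩
    intro x r hr hrr hst
    by_contra hcon
    push Not at hcon
    have hpos := road_pos_of_strip C hκ hr0 hI hr hst
    have hx := hpos x (by linarith)
    have hp := hpar r x hr hrr (fun x' h => hpos x' (by linarith)) hst
    have hl : 0 < c4 * √r := mul_pos hc4 (Real.sqrt_pos.2 hr)
    have hl2 : (c4 * √r) ^ 2 = c4 ^ 2 * r := by rw [mul_pow, Real.sq_sqrt hr.le]
    set l := c4 * √r with hldef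
    set m := -pdx u x 0 with hm
    have hm0 : 0 < m := by have := C.mono x 0 le_rfl hx; linarith
    have hpb : ∀ z ∈ Icc (x - θ * l) x, 0 < u z 0 := fun z hz => hpos z (by linarith [hz.2])
    have hτ : 0 < θ * l := by positivity
    have hτl : θ * l ≤ l := by nlinarith
    have t1 := taylor_bwd (a := x - θ * l) (b := x) (by linarith) (fun z hz => hdx z (hpb z hz))
      (fun z hz => hdxx z (hpb z hz)) (fun z hz => hxx z (hpb z hz))
    have t2 := hp (θ * l) hτ.le (by linarith)
    rw [sub_sub_cancel] at t1
    have t3 : β * (θ * l) * l ≤ β * (θ * l) * (2 * l - θ * l) :=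
      mul_le_mul_of_nonneg_left (by linarith) (by positivity)
    have t4 : u x 0 ≤ (θ * l) * (β * l / 4) := by
      have : ε * r ≤ c4 ^ 2 * θ * β / 4 * r := mul_le_mul_of_nonneg_right hε1 hr.le
      have e : c4 ^ 2 * θ * β / 4 * r = (θ * l) * (β * l / 4) := by
        calc c4 ^ 2 * θ * β / 4 * r = (c4 ^ 2 * r) * θ * β / 4 := by ring
          _ = _ := by rw [← hl2]; ring
      linarith
    have t5 : C0 * (θ * l) ^ 2 / 2 ≤ (θ * l) * (β * l / 4) := by
      have : (C0 * θ) * (l * (θ * l)) ≤ β / 2 * (l * (θ * l)) := mul_le_mul_of_nonneg_right hθ2 (by positivity)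
      nlinarith
    have t6 : β * l / 2 ≤ m := by
      have : (θ * l) * (β * l / 2) ≤ (θ * l) * m := by
        rw [hm]; nlinarith
      exact le_of_mul_le_mul_left this hτ
    -- forward
    have hT0 : 0 < m / (2 * C0) := by positivity
    have hT1 : C0 * (m / (2 * C0)) = m / 2 := by field_simp
    have hpf := hii x hx (m / (2 * C0)) hT0.le (by rw [hT1]; linarith)
    set T := m / (2 * C0) with hT
    have hpf' : ∀ z ∈ Icc x (x + T), 0 < u z 0 := fun z hz => C.down z (x + T) 0 le_rfl hz.2 hpf
    have t7 := taylor_fwd (a := x) (b := x + T) (by linarith) (fun z hz => hdx z (hpf' z hz))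
      (fun z hz => hdxx z (hpf' z hz)) (fun z hz => hxx z (hpf' z hz))
    rw [add_sub_cancel_left] at t7
    have t8 : m * T / 2 ≤ u x 0 := by
      have e1 : C0 * T ^ 2 / 2 = m * T / 4 := by
        calc C0 * T ^ 2 / 2 = (C0 * T) * T / 2 := by ring
          _ = _ := by rw [hT1]; ring
      rw [e1] at t7
      have : pdx u x 0 = -m := by rw [hm]; ring
      rw [this] at t7
      have := mul_pos hm0 hT0
      linarith
    have t9 : β ^ 2 * c4 ^ 2 / (16 * C0) * r ≤ m * T / 2 := by
      have e1 : m * T / 2 = m ^ 2 / (4 * C0) := by rw [hT]; field_simp; ring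
      have e2 : β ^ 2 * c4 ^ 2 / (16 * C0) * r = (β * l / 2) ^ 2 / (4 * C0) := by
        rw [show (β * l / 2) ^ 2 = β ^ 2 * l ^ 2 / 4 by ring, hl2]; field_simp; ring
      rw [e1, e2]
      apply div_le_div_of_nonneg_right _ (by positivity)
      exact pow_le_pow_left₀ (by positivity) t6 2
    have : ε * r ≤ β ^ 2 * c4 ^ 2 / (16 * C0) * r := mul_le_mul_of_nonneg_right hε2 hr.le
    linarith
  · push Not at hii
    obtain ⟨x2, hx2, t, ht, ht2, hz⟩ := hii
    set σ := -pdx u x2 0 - C0 * t with hσ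
    have hσ0 : 0 < σ := by linarith
    refine ⟨min (u x2 0 / r1) (σ / 2), lt_min (by positivity) (by positivity), r1, hr1, ?_⟩
    intro x r hr hrr hst
    have hpos := road_pos_of_strip C hκ hr0 hI hr hst
    have hxt : x + r ≤ x2 + t := by
      by_contra h
      push Not at h
      exact absurd (hpos _ h) (not_lt.2 hz)
    rcases le_or_gt x x2 with h | h
    · calc min (u x2 0 / r1) (σ / 2) * r ≤ u x2 0 / r1 * r1 :=
            mul_le_mul (min_le_left _ _) hrr hr.le (by positivity)
        _ = u x2 0 := by field_simp
        _ ≤ u x 0 := C.anti x x2 0 le_rfl h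
    · have hp2 : ∀ z ∈ Icc x2 (x + r / 2), 0 < u z 0 := fun z hz => hpos z (by linarith [hz.2])
      have hder : ∀ z ∈ Icc x (x + r / 2), pdx u z 0 ≤ -σ := by
        intro z hz
        have := mv_le (f := fun t => pdx u t 0) (a := x2) (b := z) (by linarith [hz.1])
          (fun s hs => hdxx s (hp2 s ⟨hs.1, hs.2.trans hz.2⟩)) (fun s hs => hxx s (hp2 s ⟨hs.1, hs.2.trans hz.2⟩))
        have h3 : C0 * (z - x2) ≤ C0 * t := mul_le_mul_of_nonneg_left (by linarith [hz.2]) hC0p.le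
        linarith
      have := mv_le (f := fun t => u t 0) (a := x) (b := x + r / 2) (by linarith)
        (fun z hz => hdx z (hp2 z ⟨by linarith [hz.1], hz.2⟩)) hder
      have h5 := (C.tw.mem01 (x + r / 2) 0 le_rfl).1
      have h6 : min (u x2 0 / r1) (σ / 2) * r ≤ σ / 2 * r := mul_le_mul_of_nonneg_right (min_le_right _ _) hr.le
      linarith

theorem near_est {d D μ c K : ℝ} {u : ℝ → ℝ → ℝ} {φ : ℝ → ℝ} (C : Ctx d D μ c K u φ) :
    ∃ κ3 > 0, ∃ r1 > 0, ∀ x y r, y ≤ 0 → 0 < u x y → 0 < r → r ≤ r1 →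
      r ≤ Metric.infDist (x, y) (freeBdry u) → κ3 * r ≤ u x y := by
  obtain ⟨κ, hκ, hκ1, r0, hr0, hI⟩ := interior_est C
  obtain ⟨ε, hε, r1, hr1, hroad⟩ := road_est C hκ hr0 hI
  have hK0 : 0 < K := by linarith [C.hK]
  obtain ⟨κ1, hκ10, hk1, hk2⟩ : ∃ κ1 > 0, κ1 ≤ 1 / 4 ∧ K * κ1 ≤ ε / 4 := by
    refine ⟨min (1 / 4) (ε / (4 * K)), lt_min (by norm_num) (by positivity), min_le_left _ _, ?_⟩
    calc K * min (1 / 4) (ε / (4 * K)) ≤ K * (ε / (4 * K)) := mul_le_mul_of_nonneg_left (min_le_right _ _) hK0.le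
      _ = ε / 4 := by field_simp
  refine ⟨min (κ * κ1) (ε / 4), lt_min (by positivity) (by positivity), min r0 r1, lt_min hr0 hr1, ?_⟩
  intro x y r hy hp hr hrr hdist
  have hr0' := hrr.trans (min_le_left _ _)
  have hr1' := hrr.trans (min_le_right _ _)
  have hs := strip_of_dist C hy hp hr hdist
  have hk1r : κ1 * r ≤ r / 4 := by nlinarith
  have hk0r : 0 < κ1 * r := by positivity
  rcases le_or_gt (κ1 * r) (-y) with h | h
  · have := hI x y (κ1 * r) hk0r (by linarith) (by linarith) (by
      intro x' y' hq
      have h1 : |x' - x| < κ1 * r := abs_lt_of_sq_lt_sq (by nlinarith [sq_nonneg (y' - y)]) hk0r.le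
      have h2 : |y' - y| < κ1 * r := abs_lt_of_sq_lt_sq (by nlinarith [sq_nonneg (x' - x)]) hk0r.le
      have h3 := abs_lt.1 h1
      have h4 := abs_lt.1 h2
      have hy' : y' < 0 := by linarith
      rw [C.pos _ _ hy']
      have := hs y' hy' (by linarith)
      linarith)
    have h2 : min (κ * κ1) (ε / 4) * r ≤ κ * κ1 * r := mul_le_mul_of_nonneg_right (min_le_left _ _) hr.le
    linarith
  · have h1 := hroad x (r / 2) (by positivity) (by linarith) (by
      intro x' y' h1 h2 h3
      rw [C.pos _ _ h3]
      have := hs y' h3 (by rw [abs_lt]; constructor <;> linarith)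
      linarith)
    have := C.lip x 0 x y le_rfl hy
    rw [sub_self, abs_zero, zero_sub, abs_of_nonneg (by linarith : 0 ≤ -y), max_eq_right (by linarith)] at this
    have h3 := (abs_le.1 this).2
    have h4 : K * (-y) ≤ K * (κ1 * r) := mul_le_mul_of_nonneg_left h.le hK0.le
    have h5 : K * κ1 * r ≤ ε / 4 * r := mul_le_mul_of_nonneg_right hk2 hr.le
    have h2 : min (κ * κ1) (ε / 4) * r ≤ ε / 4 * r := mul_le_mul_of_nonneg_right (min_le_right _ _) hr.le
    linarith

theorem exp_lin_deriv (a b t : ℝ) : HasDerivAt (fun t => Real.exp (a * t + b)) (a * Real.exp (a * t + b)) t := by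
  have h1 : HasDerivAt (fun t : ℝ => a * t + b) a t := by
    simpa using ((hasDerivAt_id t).const_mul a).add_const b
  exact h1.exp.congr_deriv (by ring)

theorem sig_exists {d D μ c : ℝ} (hd : 0 < d) (hD : 0 < D) (hμ : 0 < μ) (hc : 0 < c) :
    ∃ σ > 0, ∃ l > 0, d * σ ^ 2 < c * σ ∧ D * σ ^ 2 < c * σ ∧ d * (σ ^ 2 + l ^ 2) < c * σ ∧
      D * σ ^ 2 + (1 / μ) * l < c * σ := by
  obtain ⟨σ, hσ, h1, h2⟩ : ∃ σ > 0, d * σ ≤ c / 4 ∧ D * σ ≤ c / 4 := by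
    refine ⟨min (c / (4 * d)) (c / (4 * D)), lt_min (by positivity) (by positivity), ?_, ?_⟩
    · calc d * min (c / (4 * d)) (c / (4 * D)) ≤ d * (c / (4 * d)) := mul_le_mul_of_nonneg_left (min_le_left _ _) hd.le
        _ = c / 4 := by field_simp
    · calc D * min (c / (4 * d)) (c / (4 * D)) ≤ D * (c / (4 * D)) := mul_le_mul_of_nonneg_left (min_le_right _ _) hD.le
        _ = c / 4 := by field_simp
  obtain ⟨l, hl, h3, h4⟩ : ∃ l > 0, l ≤ σ ∧ (1 / μ) * l ≤ c * σ / 4 := by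
    refine ⟨min σ (μ * (c * σ / 4)), lt_min hσ (by positivity), min_le_left _ _, ?_⟩
    calc (1 / μ) * min σ (μ * (c * σ / 4)) ≤ (1 / μ) * (μ * (c * σ / 4)) :=
          mul_le_mul_of_nonneg_left (min_le_right _ _) (by positivity)
      _ = c * σ / 4 := by field_simp
  have e1 : d * σ ^ 2 ≤ c * σ / 4 := by nlinarith
  have e2 : D * σ ^ 2 ≤ c * σ / 4 := by nlinarith
  have e3 : d * l ^ 2 ≤ d * σ ^ 2 := mul_le_mul_of_nonneg_left (pow_le_pow_left₀ hl.le h3 2) hd.le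
  have e4 : 0 < c * σ := by positivity
  exact ⟨σ, hσ, l, hl, by linarith, by linarith, by linarith, by linarith⟩

theorem exists_deep {ε l A y0 : ℝ} (hε : 0 < ε) (hl : 0 < l) :
    ∃ Y > 0, -Y ≤ y0 ∧ 1 ≤ ε * (Real.exp A * Real.exp (l * Y)) := by
  have h1 : Tendsto (fun Y => ε * (Real.exp A * Real.exp (l * Y))) atTop atTop :=
    ((Real.tendsto_exp_atTop.comp (tendsto_id.const_mul_atTop hl)).const_mul_atTop (Real.exp_pos A)).const_mul_atTop hε
  obtain ⟨Y, h, h2, h3⟩ := ((h1.eventually_ge_atTop 1).and ((eventually_gt_atTop 0).and (eventually_ge_atTop (-y0)))).exists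
  exact ⟨Y, h2, by linarith, h⟩

theorem far1 {d D μ c K : ℝ} {u : ℝ → ℝ → ℝ} {φ : ℝ → ℝ} (C : Ctx d D μ c K u φ) {M σ l : ℝ}
    (hM : ∀ x ≤ M, ∀ y ≤ (0:ℝ), 0 < u x y) (hσ : 0 < σ) (hl : 0 < l)
    (g1 : d * σ ^ 2 < c * σ) (g2 : D * σ ^ 2 < c * σ) (g3 : d * (σ ^ 2 + l ^ 2) < c * σ)
    (g4 : D * σ ^ 2 + (1 / μ) * l < c * σ) :
    ∀ x y, y ≤ 0 → 1 - Real.exp (σ * (x - M)) ≤ u x y := by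
  intro x0 y0 hy0
  have hu0 := fun x y (h : y ≤ 0) => (C.tw.mem01 x y h).1
  rcases le_or_gt M x0 with hx0 | hx0
  · have : 1 ≤ Real.exp (σ * (x0 - M)) := Real.one_le_exp (mul_nonneg hσ.le (by linarith))
    linarith [hu0 x0 y0 hy0]
  refine le_of_forall_pos_le_add ?_
  intro η hη
  set G := Real.exp (σ * x0) * Real.exp (-l * y0) with hG
  have hG0 : 0 < G := by positivity
  set ε := η / 2 / G with hε
  have hε0 : 0 < ε := by positivity
  have hεG : ε * G = η / 2 := by rw [hε]; field_simp
  obtain ⟨A', hA'⟩ := C.tw.lim_left (η / 2) (by positivity)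
  obtain ⟨A, hA1, hA2, hA3⟩ : ∃ A, A ≤ A' ∧ A ≤ x0 ∧ A < M := ⟨min A' x0, min_le_left _ _, min_le_right _ _, by
    exact lt_of_le_of_lt (min_le_right _ _) hx0⟩
  obtain ⟨Y, hY, hY1, hY2⟩ := exists_deep (A := σ * A) (y0 := y0) hε0 hl
  set w : ℝ → ℝ → ℝ := fun x y => 1 - η / 2 - Real.exp (σ * x + (-(σ * M))) -
    ε * (Real.exp (σ * x + 0) * Real.exp (-l * y + 0)) with hw
  have hcomp := compare C.hd C.hD C.hμ C.tw (R := Icc A M ×ˢ Icc (-Y) 0) (w := w)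
    (isCompact_Icc.prod isCompact_Icc) (fun p hp => hp.2.2) (by simp only [hw]; fun_prop) (by
    rintro x y ⟨⟨hx1, hx2⟩, hy1, hy2⟩
    dsimp only at hx1 hx2 hy1 hy2
    have hE0 : 0 < Real.exp (σ * x + (-(σ * M))) := Real.exp_pos _
    have hE1 : 0 < ε * (Real.exp (σ * x + 0) * Real.exp (-l * y + 0)) := by positivity
    rcases hx2.lt_or_eq with hx2 | hx2
    swap
    · left
      have : Real.exp (σ * x + (-(σ * M))) = 1 := by rw [hx2, add_neg_cancel, Real.exp_zero]
      have := hu0 x y hy2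
      simp only [hw]
      linarith
    rcases hx1.lt_or_eq with hx1 | hx1
    swap
    · left
      have := (abs_lt.1 (hA' x (by linarith) y hy2)).1
      simp only [hw]
      linarith
    rcases hy1.lt_or_eq with hy1 | hy1
    swap
    · left
      have h1 : Real.exp (σ * A) * Real.exp (l * Y) ≤ Real.exp (σ * x + 0) * Real.exp (-l * y + 0) := by
        rw [← Real.exp_add, ← Real.exp_add, Real.exp_le_exp, ← hy1]
        nlinarith
      have h2 := mul_le_mul_of_nonneg_left h1 hε0.le
      have := hu0 x y hy2
      simp only [hw]
      linarith
    have hdx : ∀ y t : ℝ, HasDerivAt (fun t => w t y) (-(σ * Real.exp (σ * t + (-(σ * M)))) -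
        ε * (σ * Real.exp (σ * t + 0) * Real.exp (-l * y + 0))) t := by
      intro y t
      have h2 : HasDerivAt (fun t => w t y) _ t :=
        ((exp_lin_deriv σ (-(σ * M)) t).const_sub (1 - η / 2)).sub
          (((exp_lin_deriv σ 0 t).mul_const (Real.exp (-l * y + 0))).const_mul ε)
      exact h2
    have hdxx : ∀ y : ℝ, HasDerivAt (fun t => -(σ * Real.exp (σ * t + (-(σ * M)))) -
        ε * (σ * Real.exp (σ * t + 0) * Real.exp (-l * y + 0))) (-(σ * (σ * Real.exp (σ * x + (-(σ * M))))) -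
        ε * (σ * (σ * Real.exp (σ * x + 0)) * Real.exp (-l * y + 0))) x := by
      intro y
      exact (((exp_lin_deriv σ (-(σ * M)) x).const_mul σ).neg).sub
          ((((exp_lin_deriv σ 0 x).const_mul σ).mul_const (Real.exp (-l * y + 0))).const_mul ε)
    have hdy : ∀ t : ℝ, HasDerivAt (fun t => w x t) (-(ε * (Real.exp (σ * x + 0) * (-l * Real.exp (-l * t + 0))))) t := by
      intro t
      have h2 : HasDerivAt (fun t => w x t) _ t :=
        (((exp_lin_deriv (-l) 0 t).const_mul (Real.exp (σ * x + 0))).const_mul ε).const_sub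
          (1 - η / 2 - Real.exp (σ * x + (-(σ * M))))
      exact h2
    have hdyy : HasDerivAt (fun t => -(ε * (Real.exp (σ * x + 0) * (-l * Real.exp (-l * t + 0)))))
        (-(ε * (Real.exp (σ * x + 0) * (-l * (-l * Real.exp (-l * y + 0)))))) y :=
      ((((exp_lin_deriv (-l) 0 y).const_mul (-l)).const_mul (Real.exp (σ * x + 0))).const_mul ε).neg
    rcases hy2.lt_or_eq with hy2 | hy2
    · right; left
      refine ⟨hM x hx2.le y hy2.le, hy2, prod_mem_nhds (Icc_mem_nhds hx1 hx2) (Icc_mem_nhds hy1 hy2),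
        fun x y => -(σ * Real.exp (σ * x + (-(σ * M)))) - ε * (σ * Real.exp (σ * x + 0) * Real.exp (-l * y + 0)),
        fun x y => -(ε * (Real.exp (σ * x + 0) * (-l * Real.exp (-l * y + 0)))), _, _,
        ⟨Eventually.of_forall (hdx y), hdxx y, Eventually.of_forall hdy, hdyy⟩, ?_⟩
      set E := Real.exp (σ * x + (-(σ * M)))
      set F := ε * (Real.exp (σ * x + 0) * Real.exp (-l * y + 0)) with hF
      have i1 := mul_lt_mul_of_pos_right g1 hE0
      have i2 := mul_lt_mul_of_pos_right g3 hE1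
      rw [← sub_pos]
      have e : d * (-(σ * (σ * E)) - ε * (σ * (σ * Real.exp (σ * x + 0)) * Real.exp (-l * y + 0)) +
        -(ε * (Real.exp (σ * x + 0) * (-l * (-l * Real.exp (-l * y + 0)))))) -
        c * (-(σ * E) - ε * (σ * Real.exp (σ * x + 0) * Real.exp (-l * y + 0))) =
        (c * σ * E - d * σ ^ 2 * E) + (c * σ * F - d * (σ ^ 2 + l ^ 2) * F) := by rw [hF]; ring
      rw [e]
      linarith
    · right; right
      subst hy2
      refine ⟨hM x hx2.le 0 le_rfl, rfl, box_road hx1 hx2 hY,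
        fun x => -(σ * Real.exp (σ * x + (-(σ * M)))) - ε * (σ * Real.exp (σ * x + 0) * Real.exp (-l * 0 + 0)),
        _, _, Eventually.of_forall (hdx 0), hdxx 0, hdy 0, ?_⟩
      set E := Real.exp (σ * x + (-(σ * M)))
      set F := ε * (Real.exp (σ * x + 0) * Real.exp (-l * 0 + 0)) with hF
      have i1 := mul_lt_mul_of_pos_right g2 hE0
      have i2 := mul_lt_mul_of_pos_right g4 hE1
      rw [← sub_pos]
      have e : 0 - (-D * (-(σ * (σ * E)) - ε * (σ * (σ * Real.exp (σ * x + 0)) * Real.exp (-l * 0 + 0))) +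
        c * (-(σ * E) - ε * (σ * Real.exp (σ * x + 0) * Real.exp (-l * 0 + 0))) +
        1 / μ * (-(ε * (Real.exp (σ * x + 0) * (-l * Real.exp (-l * 0 + 0)))))) =
        (c * σ * E - D * σ ^ 2 * E) + (c * σ * F - (D * σ ^ 2 + 1 / μ * l) * F) := by rw [hF]; ring
      rw [e]
      linarith)
  have := hcomp x0 y0 ⟨⟨hA2, hx0.le⟩, ⟨hY1, hy0⟩⟩
  simp only [hw, add_zero] at this
  rw [← hG, hεG] at this
  rw [show σ * (x0 - M) = σ * x0 + -(σ * M) by ring]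
  linarith

set_option maxHeartbeats 1000000 in
theorem far2 {d D μ c K : ℝ} {u : ℝ → ℝ → ℝ} {φ : ℝ → ℝ} (C : Ctx d D μ c K u φ)
    (hφa : AnalyticOnNhd ℝ φ (Iio 0)) {ρ σ l P b C' : ℝ}
    (hb : b < 0) (hP : ∀ y ≤ b, |deriv φ y| ≤ P) (hP2 : ∀ y ≤ b, d * |deriv (deriv φ) y| ≤ c / 2)
    (hρ : 0 < ρ) (hρP : d * (ρ * (1 + P ^ 2)) ≤ c / 2) (hC' : 1 ≤ C')
    (hσ : 0 < σ) (hl : 0 < l) (g3 : d * (σ ^ 2 + l ^ 2) < c * σ)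
    (hbd : ∀ x ≤ φ b, 1 - C' * Real.exp (ρ * (x - φ b)) ≤ u x b) :
    ∀ x y, y ≤ b → x ≤ φ y → 1 - C' * Real.exp (ρ * (x - φ y)) ≤ u x y := by
  intro x0 y0 hy0 hx0
  have hd := C.hd
  have hu0 := fun x y (h : y ≤ 0) => (C.tw.mem01 x y h).1
  refine le_of_forall_pos_le_add ?_
  intro η hη
  set G := Real.exp (σ * x0) * Real.exp (-l * y0) with hG
  have hG0 : 0 < G := by positivity
  set ε := η / 2 / G with hε
  have hε0 : 0 < ε := by positivity
  have hεG : ε * G = η / 2 := by rw [hε]; field_simp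
  obtain ⟨A', hA'⟩ := C.tw.lim_left (η / 2) (by positivity)
  obtain ⟨A, hA1, hA2⟩ : ∃ A, A ≤ A' ∧ A ≤ x0 := ⟨min A' x0, min_le_left _ _, min_le_right _ _⟩
  obtain ⟨Y, hY, hY1, hY2⟩ := exists_deep (A := σ * A) (y0 := y0) hε0 hl
  obtain ⟨Φ, hΦ⟩ : ∃ Φ, ∀ y ∈ Icc (-Y) b, φ y ≤ Φ := by
    obtain ⟨Φ, h⟩ := (isCompact_Icc (a := -Y) (b := b)).bddAbove_image
      (C.hφ.mono (fun y hy' => lt_of_le_of_lt hy'.2 hb))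
    exact ⟨Φ, fun y hy' => h ⟨y, hy', rfl⟩⟩
  set Bx : Set (ℝ × ℝ) := Icc A Φ ×ˢ Icc (-Y) b with hBx
  have hBc : IsCompact Bx := isCompact_Icc.prod isCompact_Icc
  have hφB : ContinuousOn (fun p : ℝ × ℝ => φ p.2) Bx :=
    C.hφ.comp (f := fun p : ℝ × ℝ => p.2) (by fun_prop) (fun p hp => lt_of_le_of_lt hp.2.2 hb)
  set R : Set (ℝ × ℝ) := {p | p ∈ Bx ∧ p.1 ≤ φ p.2} with hR
  have hRc : IsCompact R := by
    refine hBc.of_isClosed_subset (hBc.isClosed.isClosed_le (by fun_prop) hφB) (fun p hp => hp.1)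
  set w : ℝ → ℝ → ℝ := fun x y => 1 - η / 2 - C' * Real.exp (ρ * x + (-(ρ * φ y))) -
    ε * (Real.exp (σ * x + 0) * Real.exp (-l * y + 0)) with hw
  have hwc : ContinuousOn (fun p : ℝ × ℝ => w p.1 p.2) R := by
    have h1 : ContinuousOn (fun p : ℝ × ℝ => φ p.2) R := hφB.mono (fun p (hp : p ∈ R) => hp.1)
    have h2 : ContinuousOn (fun p : ℝ × ℝ => Real.exp (ρ * p.1 + (-(ρ * φ p.2)))) R :=
      Real.continuous_exp.comp_continuousOn ((continuousOn_const.mul continuous_fst.continuousOn).add ((continuousOn_const.mul h1).neg))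
    have h3 : Continuous (fun p : ℝ × ℝ => ε * (Real.exp (σ * p.1 + 0) * Real.exp (-l * p.2 + 0))) := by fun_prop
    exact (continuousOn_const.sub (continuousOn_const.mul h2)).sub h3.continuousOn
  have hcomp := compare C.hd C.hD C.hμ C.tw hRc (fun p hp => hp.1.2.2.trans hb.le) hwc (by
    rintro x y ⟨⟨⟨hx1, hx3⟩, hy1, hy2⟩, hx2⟩
    dsimp only at hx1 hx2 hx3 hy1 hy2
    have hyn : y < 0 := lt_of_le_of_lt hy2 hb
    have hE0 : 0 < C' * Real.exp (ρ * x + (-(ρ * φ y))) := by positivity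
    have hE1 : 0 < ε * (Real.exp (σ * x + 0) * Real.exp (-l * y + 0)) := by positivity
    rcases hx2.lt_or_eq with hx2 | hx2
    swap
    · left
      have : Real.exp (ρ * x + (-(ρ * φ y))) = 1 := by rw [hx2, add_neg_cancel, Real.exp_zero]
      have := hu0 x y hyn.le
      simp only [hw]
      nlinarith
    rcases hx1.lt_or_eq with hx1 | hx1
    swap
    · left
      have := (abs_lt.1 (hA' x (by linarith) y hyn.le)).1
      simp only [hw]
      linarith
    rcases hy1.lt_or_eq with hy1 | hy1
    swap
    · left
      have h1 : Real.exp (σ * A) * Real.exp (l * Y) ≤ Real.exp (σ * x + 0) * Real.exp (-l * y + 0) := by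
        rw [← Real.exp_add, ← Real.exp_add, Real.exp_le_exp, ← hy1]
        nlinarith
      have h2 := mul_le_mul_of_nonneg_left h1 hε0.le
      have := hu0 x y hyn.le
      simp only [hw]
      linarith
    rcases hy2.lt_or_eq with hy2 | hy2
    swap
    · left
      subst hy2
      have := hbd x hx2.le
      rw [show ρ * (x - φ y) = ρ * x + (-(ρ * φ y)) by ring] at this
      simp only [hw]
      linarith
    right; left
    have hφd : ∀ t < (0:ℝ), HasDerivAt φ (deriv φ t) t := fun t ht => (hφa t ht).differentiableAt.hasDerivAt
    have hφdd : HasDerivAt (deriv φ) (deriv (deriv φ) y) y := (hφa.deriv y hyn).differentiableAt.hasDerivAt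
    have hφe : ∀ t < (0:ℝ), HasDerivAt (fun t => Real.exp (ρ * x + (-(ρ * φ t))))
        (Real.exp (ρ * x + (-(ρ * φ t))) * (-(ρ * deriv φ t))) t := by
      intro t ht
      exact ((((hφd t ht).const_mul ρ).neg).const_add (ρ * x)).exp
    have hdx : ∀ t : ℝ, HasDerivAt (fun t => w t y) (-(C' * (ρ * Real.exp (ρ * t + (-(ρ * φ y))))) -
        ε * (σ * Real.exp (σ * t + 0) * Real.exp (-l * y + 0))) t := by
      intro t
      have h2 : HasDerivAt (fun t => w t y) _ t :=
        (((exp_lin_deriv ρ (-(ρ * φ y)) t).const_mul C').const_sub (1 - η / 2)).sub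
          (((exp_lin_deriv σ 0 t).mul_const (Real.exp (-l * y + 0))).const_mul ε)
      exact h2
    have hdxx : HasDerivAt (fun t => -(C' * (ρ * Real.exp (ρ * t + (-(ρ * φ y))))) -
        ε * (σ * Real.exp (σ * t + 0) * Real.exp (-l * y + 0))) (-(C' * (ρ * (ρ * Real.exp (ρ * x + (-(ρ * φ y)))))) -
        ε * (σ * (σ * Real.exp (σ * x + 0)) * Real.exp (-l * y + 0))) x := by
      exact ((((exp_lin_deriv ρ (-(ρ * φ y)) x).const_mul ρ).const_mul C').neg).sub
          ((((exp_lin_deriv σ 0 x).const_mul σ).mul_const (Real.exp (-l * y + 0))).const_mul ε)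
    have hdy : ∀ t < (0:ℝ), HasDerivAt (fun t => w x t) (-(C' * (Real.exp (ρ * x + (-(ρ * φ t))) * (-(ρ * deriv φ t))))
        - (ε * (Real.exp (σ * x + 0) * (-l * Real.exp (-l * t + 0))))) t := by
      intro t ht
      have h2 : HasDerivAt (fun t => w x t) _ t :=
        (((hφe t ht).const_mul C').const_sub (1 - η / 2)).sub
        (((exp_lin_deriv (-l) 0 t).const_mul (Real.exp (σ * x + 0))).const_mul ε)
      exact h2
    have hdyy : HasDerivAt (fun t => -(C' * (Real.exp (ρ * x + (-(ρ * φ t))) * (-(ρ * deriv φ t))))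
        - (ε * (Real.exp (σ * x + 0) * (-l * Real.exp (-l * t + 0)))))
        (-(C' * ((Real.exp (ρ * x + (-(ρ * φ y))) * (-(ρ * deriv φ y))) * (-(ρ * deriv φ y)) +
          Real.exp (ρ * x + (-(ρ * φ y))) * (-(ρ * deriv (deriv φ) y))))
        - (ε * (Real.exp (σ * x + 0) * (-l * (-l * Real.exp (-l * y + 0)))))) y :=
      ((((hφe y hyn).mul ((hφdd.const_mul ρ).neg)).const_mul C').neg).sub
      ((((exp_lin_deriv (-l) 0 y).const_mul (-l)).const_mul (Real.exp (σ * x + 0))).const_mul ε)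
    refine ⟨(C.pos x y hyn).2 hx2, hyn, ?_,
        fun x y => -(C' * (ρ * Real.exp (ρ * x + (-(ρ * φ y))))) - ε * (σ * Real.exp (σ * x + 0) * Real.exp (-l * y + 0)),
        fun x y => -(C' * (Real.exp (ρ * x + (-(ρ * φ y))) * (-(ρ * deriv φ y))))
        - (ε * (Real.exp (σ * x + 0) * (-l * Real.exp (-l * y + 0)))), _, _,
        ⟨Eventually.of_forall hdx, hdxx, ?_, hdyy⟩, ?_⟩
    · have hφc : ContinuousAt (fun p : ℝ × ℝ => φ p.2 - p.1) (x, y) := by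
        have h1 : ContinuousAt φ y := (hφd y hyn).continuousAt
        have h2 : ContinuousAt (fun p : ℝ × ℝ => φ p.2) (x, y) :=
          ContinuousAt.comp (f := fun p : ℝ × ℝ => p.2) (x := (x, y)) h1 continuous_snd.continuousAt
        exact h2.sub continuous_fst.continuousAt
      have e1 := hφc.eventually (lt_mem_nhds (show (0:ℝ) < φ y - x by linarith))
      have e2 : ∀ᶠ p : ℝ × ℝ in 𝓝 (x, y), A < p.1 := continuous_fst.continuousAt.eventually (lt_mem_nhds hx1)
      have e3 : ∀ᶠ p : ℝ × ℝ in 𝓝 (x, y), -Y < p.2 := continuous_snd.continuousAt.eventually (lt_mem_nhds hy1)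
      have e4 : ∀ᶠ p : ℝ × ℝ in 𝓝 (x, y), p.2 < b := continuous_snd.continuousAt.eventually (gt_mem_nhds hy2)
      filter_upwards [e1, e2, e3, e4] with p h1 h2 h3 h4
      have h5 := hΦ p.2 ⟨h3.le, h4.le⟩
      exact ⟨⟨⟨h2.le, by linarith⟩, ⟨h3.le, h4.le⟩⟩, by linarith⟩
    · filter_upwards [gt_mem_nhds hyn] with t ht using hdy t ht
    · have q1 := hP y hy2.le
      have q2 := hP2 y hy2.le
      set p := deriv φ y
      set p' := deriv (deriv φ) y
      have q3 : p ^ 2 ≤ P ^ 2 := by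
        rw [← sq_abs p]; exact pow_le_pow_left₀ (abs_nonneg _) q1 2
      have q4 : d * (-p') ≤ c / 2 := le_trans (mul_le_mul_of_nonneg_left (neg_le_abs p') hd.le) q2
      have q5 : d * (ρ * (1 + p ^ 2)) ≤ c / 2 := by
        refine le_trans ?_ hρP
        apply mul_le_mul_of_nonneg_left _ hd.le
        apply mul_le_mul_of_nonneg_left _ hρ.le
        linarith
      have q6 : 0 ≤ c - d * (ρ * (1 + p ^ 2)) - d * (-p') := by linarith
      set X := Real.exp (ρ * x + (-(ρ * φ y)))
      set F := ε * (Real.exp (σ * x + 0) * Real.exp (-l * y + 0)) with hF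
      have i1 : 0 ≤ (C' * X) * (ρ * (c - d * (ρ * (1 + p ^ 2)) - d * (-p'))) :=
        mul_nonneg hE0.le (mul_nonneg hρ.le q6)
      have i2 := mul_lt_mul_of_pos_right g3 hE1
      rw [← sub_pos]
      have e : d * (-(C' * (ρ * (ρ * X))) - ε * (σ * (σ * Real.exp (σ * x + 0)) * Real.exp (-l * y + 0)) +
        (-(C' * ((X * (-(ρ * p))) * (-(ρ * p)) + X * (-(ρ * p'))))
        - (ε * (Real.exp (σ * x + 0) * (-l * (-l * Real.exp (-l * y + 0))))))) -
        c * (-(C' * (ρ * X)) - ε * (σ * Real.exp (σ * x + 0) * Real.exp (-l * y + 0))) =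
        (C' * X) * (ρ * (c - d * (ρ * (1 + p ^ 2)) - d * (-p'))) + (c * σ * F - d * (σ ^ 2 + l ^ 2) * F) := by
          rw [hF]; ring
      rw [e]
      linarith)
  have := hcomp x0 y0 ⟨⟨⟨hA2, hx0.trans (hΦ y0 ⟨hY1, hy0⟩)⟩, ⟨hY1, hy0⟩⟩, hx0⟩
  simp only [hw, add_zero] at this
  rw [← hG, hεG] at this
  rw [show ρ * (x0 - φ y0) = ρ * x0 + -(ρ * φ y0) by ring]
  linarith

theorem far_est {d D μ c K : ℝ} {u : ℝ → ℝ → ℝ} {φ : ℝ → ℝ} (C : Ctx d D μ c K u φ)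
    (hφa : AnalyticOnNhd ℝ φ (Iio 0)) {L : ℝ} (hφ1 : Tendsto (deriv φ) atBot (𝓝 L))
    (hφ2 : Tendsto (deriv (deriv φ)) atBot (𝓝 0)) :
    ∃ ρ > 0, ∃ C2 ≥ 1, ∀ x y, y ≤ 0 → 0 < u x y →
      1 - C2 * Real.exp (-(ρ * Metric.infDist (x, y) (freeBdry u))) ≤ u x y := by
  have hc0 := C.tw.c_pos
  have hd := C.hd
  obtain ⟨M, hM'⟩ := C.tw.lim_left (1 / 2) (by norm_num)
  have hM : ∀ x ≤ M, ∀ y ≤ (0:ℝ), 0 < u x y := fun x hx y hy => by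
    linarith [(abs_lt.1 (hM' x hx y hy)).1]
  obtain ⟨σ, hσ, l, hl, g1, g2, g3, g4⟩ := sig_exists hd C.hD C.hμ hc0
  have f1 := far1 C hM hσ hl g1 g2 g3 g4
  obtain ⟨b, hb, hP, hP2⟩ : ∃ b < (0:ℝ), (∀ y ≤ b, |deriv φ y| ≤ |L| + 1) ∧
      ∀ y ≤ b, d * |deriv (deriv φ) y| ≤ c / 2 := by
    have e1 : ∀ᶠ y in atBot, |deriv φ y| < |L| + 1 := hφ1.abs.eventually (gt_mem_nhds (by linarith))
    have h2 := hφ2.abs.const_mul d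
    rw [abs_zero, mul_zero] at h2
    have e2 : ∀ᶠ y in atBot, d * |deriv (deriv φ) y| < c / 2 := h2.eventually (gt_mem_nhds (by positivity))
    obtain ⟨b, hb⟩ := eventually_atBot.1 (e1.and e2)
    refine ⟨min b (-1), lt_of_le_of_lt (min_le_right _ _) (by norm_num), fun y hy => ?_, fun y hy => ?_⟩
    · exact (hb y (hy.trans (min_le_left _ _))).1.le
    · exact (hb y (hy.trans (min_le_left _ _))).2.le
  set P := |L| + 1
  obtain ⟨ρ, hρ, hρσ, hρP⟩ : ∃ ρ > 0, ρ ≤ σ ∧ d * (ρ * (1 + P ^ 2)) ≤ c / 2 := by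
    refine ⟨min σ (c / (2 * d * (1 + P ^ 2))), lt_min hσ (by positivity), min_le_left _ _, ?_⟩
    calc d * (min σ (c / (2 * d * (1 + P ^ 2))) * (1 + P ^ 2)) ≤ d * ((c / (2 * d * (1 + P ^ 2))) * (1 + P ^ 2)) := by
          apply mul_le_mul_of_nonneg_left _ hd.le
          exact mul_le_mul_of_nonneg_right (min_le_right _ _) (by positivity)
      _ = c / 2 := by field_simp
  set C' := max 1 (Real.exp (σ * (φ b - M))) with hC'
  have hC1 : 1 ≤ C' := le_max_left _ _
  have hcmp : ∀ x ≤ φ b, Real.exp (σ * (x - M)) ≤ C' * Real.exp (ρ * (x - φ b)) := by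
    intro x hx
    calc Real.exp (σ * (x - M)) = Real.exp (σ * (φ b - M)) * Real.exp (σ * (x - φ b)) := by
          rw [← Real.exp_add]; congr 1; ring
      _ ≤ C' * Real.exp (ρ * (x - φ b)) := by
          apply mul_le_mul (le_max_right _ _) _ (Real.exp_pos _).le (by positivity)
          rw [Real.exp_le_exp]
          nlinarith
  have f2 := far2 C hφa hb hP hP2 hρ hρP hC1 hσ hl g3 (fun x hx => by
    have := f1 x b hb.le
    have h2 := hcmp x hx
    linarith)
  have hexp1 : 1 ≤ Real.exp (-(ρ * b)) := Real.one_le_exp (by nlinarith)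
  refine ⟨ρ, hρ, C' * Real.exp (-(ρ * b)), by nlinarith, ?_⟩
  intro x y hy hp
  have hinf0 : 0 ≤ Metric.infDist (x, y) (freeBdry u) := Metric.infDist_nonneg
  rcases le_or_gt y b with h | h
  · have hyn : y < 0 := by linarith
    have hx := (C.pos x y hyn).1 hp
    have hm : (φ y, y) ∈ freeBdry u := by rw [C.gam]; exact ⟨y, hyn, rfl⟩
    have h1 := Metric.infDist_le_dist_of_mem (x := (x, y)) hm
    rw [Prod.dist_eq, Real.dist_eq, Real.dist_eq] at h1
    simp only [sub_self, abs_zero] at h1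
    rw [abs_of_neg (by linarith), max_eq_left (by linarith)] at h1
    have h2 := f2 x y h hx.le
    have h3 : Real.exp (ρ * (x - φ y)) ≤ Real.exp (-(ρ * Metric.infDist (x, y) (freeBdry u))) := by
      rw [Real.exp_le_exp]; nlinarith
    have h4 : C' * Real.exp (ρ * (x - φ y)) ≤ C' * Real.exp (-(ρ * b)) * Real.exp (-(ρ * Metric.infDist (x, y) (freeBdry u))) :=
      mul_le_mul (by nlinarith) h3 (Real.exp_pos _).le (by positivity)
    linarith
  · set s := Metric.infDist (x, y) (freeBdry u) with hs
    rcases le_or_gt (φ b) x with hx | hx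
    · have hsb : s ≤ -b := by
        by_contra hcon
        push Not at hcon
        have := strip_of_dist C hy hp (by linarith : 0 < s) le_rfl b hb (by
          rw [abs_lt]; constructor <;> linarith)
        linarith
      have h1 : 1 ≤ Real.exp (-(ρ * b)) * Real.exp (-(ρ * s)) := by
        rw [← Real.exp_add]; apply Real.one_le_exp; nlinarith
      have h2 := (C.tw.mem01 x y hy).1
      nlinarith
    · have hm : (φ b, b) ∈ freeBdry u := by rw [C.gam]; exact ⟨b, hb, rfl⟩
      have h1 := Metric.infDist_le_dist_of_mem (x := (x, y)) hm
      rw [Prod.dist_eq, Real.dist_eq, Real.dist_eq, ← hs] at h1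
      have h2 : s ≤ φ b - x - b := by
        refine h1.trans (max_le ?_ ?_)
        · dsimp only; rw [abs_of_neg (by linarith)]; linarith
        · dsimp only; rw [abs_of_pos (by linarith)]; linarith
      have h3 := f1 x y hy
      have h4 := hcmp x hx.le
      have h5 : Real.exp (ρ * (x - φ b)) ≤ Real.exp (-(ρ * b)) * Real.exp (-(ρ * s)) := by
        rw [← Real.exp_add, Real.exp_le_exp]; nlinarith
      have h6 := mul_le_mul_of_nonneg_left h5 (by positivity : 0 ≤ C')
      rw [mul_assoc]
      linarith

theorem final_est {d D μ c K : ℝ} {u : ℝ → ℝ → ℝ} {φ : ℝ → ℝ} (C : Ctx d D μ c K u φ)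
    (hφa : AnalyticOnNhd ℝ φ (Iio 0)) {L : ℝ} (hφ1 : Tendsto (deriv φ) atBot (𝓝 L))
    (hφ2 : Tendsto (deriv (deriv φ)) atBot (𝓝 0)) :
    ∃ ρ > (0:ℝ), ∀ x y : ℝ, y ≤ 0 → 0 < u x y →
      1 - Real.exp (-(ρ * Metric.infDist (x, y) (freeBdry u))) ≤ u x y := by
  obtain ⟨ρ, hρ, C2, hC2, hfar⟩ := far_est C hφa hφ1 hφ2
  obtain ⟨κ, hκ, r1, hr1, hnear⟩ := near_est C
  have hlog : 0 ≤ Real.log C2 := Real.log_nonneg hC2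
  obtain ⟨S, hS, hSr, hSC⟩ : ∃ S > 0, r1 ≤ S ∧ Real.log C2 ≤ ρ * S / 2 := by
    refine ⟨r1 + 2 * Real.log C2 / ρ, by positivity, ?_, ?_⟩
    · have : 0 ≤ 2 * Real.log C2 / ρ := by positivity
      linarith
    · have : ρ * (r1 + 2 * Real.log C2 / ρ) / 2 = ρ * r1 / 2 + Real.log C2 := by field_simp
      rw [this]
      have : 0 < ρ * r1 := by positivity
      linarith
  refine ⟨min (ρ / 2) (κ * r1 / S), lt_min (by positivity) (by positivity), ?_⟩
  intro x y hy hp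
  have hs0 : 0 ≤ Metric.infDist (x, y) (freeBdry u) := Metric.infDist_nonneg
  have hf := hfar x y hy hp
  have hn := fun r => hnear x y r hy hp
  set s := Metric.infDist (x, y) (freeBdry u)
  set ρf := min (ρ / 2) (κ * r1 / S) with hρf
  have m1 : ρf ≤ ρ / 2 := min_le_left _ _
  have m2 : ρf ≤ κ * r1 / S := min_le_right _ _
  rcases hs0.lt_or_eq with hs | hs
  swap
  · rw [← hs, mul_zero, neg_zero, Real.exp_zero]; linarith
  rcases le_or_gt S s with h | h
  · have h1 : C2 * Real.exp (-(ρ * s)) ≤ Real.exp (-(ρf * s)) := by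
      have : C2 = Real.exp (Real.log C2) := (Real.exp_log (by linarith)).symm
      rw [this, ← Real.exp_add, Real.exp_le_exp]
      nlinarith
    linarith
  · have h1 : 1 - Real.exp (-(ρf * s)) ≤ ρf * s := by
      have := Real.add_one_le_exp (-(ρf * s))
      linarith
    refine h1.trans ?_
    have h2 : ρf * s ≤ κ * r1 / S * s := mul_le_mul_of_nonneg_right m2 hs.le
    rcases le_or_gt s r1 with h3 | h3
    · have := hn s hs h3 le_rfl
      refine h2.trans (le_trans ?_ this)
      apply mul_le_mul_of_nonneg_right _ hs.le
      rw [div_le_iff₀ hS]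
      exact mul_le_mul_of_nonneg_left hSr hκ.le
    · have := hn r1 hr1 le_rfl h3.le
      refine h2.trans (le_trans ?_ this)
      rw [div_mul_eq_mul_div, div_le_iff₀ hS]
      exact mul_le_mul_of_nonneg_left h.le (by positivity)

/-- Proposition 5.2: exponential approach of `u` to 1 in terms of the
distance to the free boundary. For a travelling wave `(c,u)` of the one-species problem
with `u` globally Lipschitz, `∂ₓu < 0` on `Ω`, free boundary the analytic graph
`Γ = {(φ(y),y) : y < 0}` with `φ` Lipschitz on `(-∞,-1]`, `φ'(y) → -cotan α`
(`α ∈ (0,π/2)`) and `φ''(y) → 0` as `y → -∞`: there exists `ρ > 0` such that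
`u(x,y) ≥ 1 - e^{-ρ·dist((x,y),Γ)}` wherever `u(x,y) > 0`. -/
theorem exponential_lower_bound_distance
    (d D μ c : ℝ) (hd : 0 < d) (hD : 0 < D) (hμ : 0 < μ)
    (u : ℝ → ℝ → ℝ) (hu : OneSpeciesTW d D μ c u)
    (hLip : ∃ K : NNReal, LipschitzOnWith K (fun p : ℝ × ℝ => u p.1 p.2) lowerH)
    (hmono : ∀ p ∈ posSet u, pdx u p.1 p.2 < 0)
    (φ : ℝ → ℝ)
    (hφa : AnalyticOnNhd ℝ φ (Iio 0))
    (hΓ : freeBdry u = {p : ℝ × ℝ | ∃ y < (0:ℝ), p = (φ y, y)})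
    (hφLip : ∃ K : NNReal, LipschitzOnWith K φ (Iic (-1)))
    (α : ℝ) (hα : α ∈ Ioo 0 (π/2))
    (hφ' : Tendsto (deriv φ) atBot (𝓝 (-(Real.cos α / Real.sin α))))
    (hφ'' : Tendsto (deriv (deriv φ)) atBot (𝓝 0)) :
    ∃ ρ > (0:ℝ), ∀ x y : ℝ, y ≤ 0 → 0 < u x y →
      1 - Real.exp (-(ρ * Metric.infDist (x, y) (freeBdry u))) ≤ u x y := by
  obtain ⟨K, C⟩ := mk_ctx hd hD hμ hu hLip hmono hφa hΓ
  exact final_est C hφa hφ' hφ''
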